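/- Let Λ be the limit set of a CIFS on ℝ^d with fixed point set F. Then dim_LB Λ ∈ 𝒟(dim_H Λ, dim_LB F, dim_UB F, d). In particular, if dim_UB F ≤ dim_H Λ then dim_LB Λ = dim_H Λ, and if dim_UB F > dim_H Λ then max{dim_H Λ, dim_LB F} ≤ dim_LB Λ ≤ dim_H Λ + (dim_UB F − dim_H Λ)(d − dim_H Λ)·dim_LB F / (d·dim_UB F − dim_H Λ·dim_LB F). -/

import Mathlib

open Set Metric Filter Topology MeasureTheory

noncomputable section

/-- Least number of open balls of radius `r` needed to cover `E`. -/
def coveringNumber {α : Type*} [PseudoMetricSpace α] (E : Set α) (r : ℝ) : ℕ :=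
  sInf {n : ℕ | ∃ t : Finset α, t.card = n ∧ E ⊆ ⋃ x ∈ t, Metric.ball x r}

/-- `s_E(r) = log N_r(E) / log (1/r)`. -/
def sFun {α : Type*} [PseudoMetricSpace α] (E : Set α) (r : ℝ) : ℝ :=
  Real.log (coveringNumber E r) / Real.log (1 / r)

/-- Lower box dimension. -/
def dimLB {α : Type*} [PseudoMetricSpace α] (E : Set α) : ℝ :=
  Filter.liminf (fun r => sFun E r) (nhdsWithin (0 : ℝ) (Set.Ioi 0))

/-- Upper box dimension. -/
def dimUB {α : Type*} [PseudoMetricSpace α] (E : Set α) : ℝ :=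
  Filter.limsup (fun r => sFun E r) (nhdsWithin (0 : ℝ) (Set.Ioi 0))

/-- Upper right Dini derivative. -/
def upperDini (g : ℝ → ℝ) (x : ℝ) : ℝ :=
  Filter.limsup (fun h => (g (x + h) - g x) / h) (nhdsWithin (0 : ℝ) (Set.Ioi 0))

/-- The class `𝒢(λ, α)`. -/
def GClass (lam alp : ℝ) : Set (ℝ → ℝ) :=
  {g | Continuous g ∧ (∀ x, g x ∈ Set.Icc lam alp) ∧
    ∀ x, upperDini g x ∈ Set.Icc (lam - g x) (alp - g x)}

/-- Asymptotic equivalence of two functions. -/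
def AsympEquiv (f g : ℝ → ℝ) : Prop :=
  Filter.Tendsto (fun x => f x - g x) Filter.atTop (nhds 0)

/-- `E` has covering class `g`. -/
def HasCoveringClass {α : Type*} [PseudoMetricSpace α] (E : Set α) (g : ℝ → ℝ) : Prop :=
  AsympEquiv (fun x => sFun E (Real.exp (-Real.exp x))) g

/-- Composition of the maps indexed by a finite word. -/
def compMaps {α : Type*} {I : Type*} (T : I → α → α) : List I → α → α
  | [] => id
  | i :: w => T i ∘ compMaps T w

/-- A conformal iterated function system on `ℝ^d` satisfying the open set condition
and the cone condition. -/
structure CIFS (d : ℕ) where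
  /-- the compact seed set -/
  X : Set (EuclideanSpace ℝ (Fin d))
  /-- the countable index set -/
  I : Type
  /-- the contractions -/
  S : I → EuclideanSpace ℝ (Fin d) → EuclideanSpace ℝ (Fin d)
  hXcompact : IsCompact X
  hXconn : IsConnected X
  hXint : (interior X).Nonempty
  hIcount : Countable I
  hInonempty : Nonempty I
  hSmaps : ∀ i, Set.MapsTo (S i) X X
  /-- the uniform contraction ratio -/
  c : ℝ
  hc0 : 0 < c
  hc1 : c < 1
  hcontr : ∀ i, ∀ x ∈ X, ∀ y ∈ X,
    (x ≠ y → 0 < dist (S i x) (S i y)) ∧ dist (S i x) (S i y) ≤ c * dist x y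
  /-- the open connected set on which the maps extend conformally -/
  V : Set (EuclideanSpace ℝ (Fin d))
  hVopen : IsOpen V
  hVbdd : Bornology.IsBounded V
  hVconn : IsConnected V
  hXV : X ⊆ V
  /-- the conformal extensions -/
  T : I → EuclideanSpace ℝ (Fin d) → EuclideanSpace ℝ (Fin d)
  hTagree : ∀ i, ∀ x ∈ X, T i x = S i x
  hTmaps : ∀ i, Set.MapsTo (T i) V V
  hTinj : ∀ i, Set.InjOn (T i) V
  /-- the Hölder exponent in `C^{1+ε}` -/
  eps : ℝ
  heps : 0 < eps
  hTdiff : ∀ i, ContDiffOn ℝ 1 (T i) V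
  hTholder : ∀ i, ∃ C : ℝ, 0 < C ∧ ∀ x ∈ V, ∀ y ∈ V,
    ‖fderiv ℝ (T i) x - fderiv ℝ (T i) y‖ ≤ C * ‖x - y‖ ^ eps
  hTconf : ∀ i, ∀ x ∈ V, IsConformalMap (fderiv ℝ (T i) x)
  /-- the bounded distortion constant -/
  K : ℝ
  hK : 1 ≤ K
  hBD : ∀ w : List I, ∀ x ∈ V, ∀ y ∈ V,
    ‖fderiv ℝ (compMaps T w) x‖ ≤ K * ‖fderiv ℝ (compMaps T w) y‖
  hOSCin : ∀ i, S i '' interior X ⊆ interior X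
  hOSCdisj : ∀ i j, i ≠ j → Disjoint (S i '' interior X) (S j '' interior X)
  hCone : ∃ κ : ℝ, 0 < κ ∧ ∀ x ∈ X, ∀ r : ℝ, 0 < r → r < 1 →
    ENNReal.ofReal (κ * r ^ d) ≤ volume (Metric.ball x r ∩ interior X)

/-- The limit set (attractor) of a CIFS. -/
def CIFS.limitSet {d : ℕ} (Φ : CIFS d) : Set (EuclideanSpace ℝ (Fin d)) :=
  ⋃ γ : ℕ → Φ.I, ⋂ n : ℕ, compMaps Φ.S (List.ofFn fun k : Fin (n + 1) => γ k) '' Φ.X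

/-- The set of fixed points of the maps of a CIFS. -/
def CIFS.fixedPoints {d : ℕ} (Φ : CIFS d) : Set (EuclideanSpace ℝ (Fin d)) :=
  {x | x ∈ Φ.X ∧ ∃ i, Φ.S i x = x}

/-- `ρ(w) = sup_{x ∈ X} ‖S'_w(x)‖`. -/
def CIFS.rho {d : ℕ} (Φ : CIFS d) (w : List Φ.I) : ℝ :=
  sSup ((fun x => ‖fderiv ℝ (compMaps Φ.T w) x‖) '' Φ.X)

/-- `Ψ(r, θ) = (1 - θ)·dim_H Λ + θ·s_F(r^θ)`. -/
def CIFS.Psi {d : ℕ} (Φ : CIFS d) (r θ : ℝ) : ℝ :=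
  (1 - θ) * (dimH Φ.limitSet).toReal + θ * sFun Φ.fixedPoints (r ^ θ)

/-- `ψ(r) = max_{θ ∈ [0,1]} Ψ(r,θ)` (which equals the supremum over `θ ∈ (0,1]`,
since `Ψ(r,0)` is defined as the limit of `Ψ(r,θ)` as `θ → 0⁺`). -/
def CIFS.psi {d : ℕ} (Φ : CIFS d) (r : ℝ) : ℝ :=
  sSup (Φ.Psi r '' Set.Ioc (0 : ℝ) 1)

/-- The interval `𝒟(h, s, t, α)`. -/
def Dset (h s t α : ℝ) : Set ℝ :=
  if t ≤ h then {h}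
  else Set.Icc (max h s) (h + (t - h) * (α - h) * s / (α * t - h * s))

/-- The quantity whose limit as `θ → 1⁻` is the quasi-Assouad dimension. -/
def quasiAssouadAux {α : Type*} [PseudoMetricSpace α] (E : Set α) (θ : ℝ) : ℝ :=
  sInf {t : ℝ | 0 ≤ t ∧ ∃ C : ℝ, 0 < C ∧ ∀ x ∈ E, ∀ r R : ℝ,
    0 < r → r ≤ R ^ (1 / θ) → R ^ (1 / θ) ≤ R → R < 1 →
    (coveringNumber (E ∩ Metric.ball x R) r : ℝ) ≤ C * (R / r) ^ t}

/-- The quasi-Assouad dimension. -/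
def dimqA {α : Type*} [PseudoMetricSpace α] (E : Set α) : ℝ :=
  Filter.limsup (quasiAssouadAux E) (nhdsWithin (1 : ℝ) (Set.Iio 1))

/-- The modified lower box dimension. -/
def dimLMB {α : Type*} [PseudoMetricSpace α] (K : Set α) : ℝ :=
  sInf {s : ℝ | ∃ C : ℕ → Set α, (K ⊆ ⋃ i, C i) ∧
    (∀ i, (C i).Nonempty ∧ Bornology.IsBounded (C i)) ∧ s = ⨆ i, dimLB (C i)}

/-- The unit cube `[0,1]^d`. -/
def unitCube (d : ℕ) : Set (EuclideanSpace ℝ (Fin d)) :=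
  {x | ∀ j, x j ∈ Set.Icc (0 : ℝ) 1}

/-- The basic similarity maps in the homogeneous Moran construction. -/
def moranMap (d : ℕ) (r : ℝ) (i : Fin d → Bool)
    (x : EuclideanSpace ℝ (Fin d)) : EuclideanSpace ℝ (Fin d) :=
  (EuclideanSpace.equiv (Fin d) ℝ).symm (fun j => r * x j + (if i j then 1 - r else 0))

/-- The `n`-th level of the homogeneous Moran construction. -/
def moranLevel (d : ℕ) : (ℕ → ℝ) → ℕ → Set (EuclideanSpace ℝ (Fin d))
  | _, 0 => unitCube d
  | r, n + 1 => ⋃ i : Fin d → Bool, moranMap d (r 1) i '' moranLevel d (fun k => r (k + 1)) n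

/-- The homogeneous Moran set `M(r)`. -/
def moranSet (d : ℕ) (r : ℕ → ℝ) : Set (EuclideanSpace ℝ (Fin d)) :=
  ⋂ n, moranLevel d r (n + 1)

/-- The Gauss map `x ↦ 1/x - ⌊1/x⌋`. -/
def gaussMap (x : ℝ) : ℝ := Int.fract (1 / x)

/-- The `n`-th partial quotient (continued fraction digit) of `x` (`n = 0` gives `b₁ = ⌊1/x⌋`). -/
def cfDigit (x : ℝ) (n : ℕ) : ℤ := ⌊1 / gaussMap^[n] x⌋

/-- The set of irrationals in `(0,1)` all of whose continued fraction digits lie in `I`. -/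
def cfSet (I : Set ℕ) : Set ℝ :=
  {x | x ∈ Set.Ioo (0 : ℝ) 1 ∧ Irrational x ∧ ∀ n : ℕ, ∃ b ∈ I, cfDigit x n = (b : ℤ)}

section Covering

variable {α : Type*} [PseudoMetricSpace α]

theorem coveringNumber_le_card {E : Set α} {r : ℝ} {t : Finset α}
    (h : E ⊆ ⋃ x ∈ t, ball x r) : _root_.coveringNumber E r ≤ t.card :=
  Nat.sInf_le ⟨t, rfl, h⟩

theorem exists_card_eq_coveringNumber {E : Set α} (hE : TotallyBounded E) {r : ℝ} (hr : 0 < r) :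
    ∃ t : Finset α, t.card = _root_.coveringNumber E r ∧ E ⊆ ⋃ x ∈ t, ball x r := by
  refine Nat.sInf_mem (s := {n | ∃ t : Finset α, t.card = n ∧ E ⊆ ⋃ x ∈ t, ball x r}) ?_
  obtain ⟨t, ht, h⟩ := Metric.totallyBounded_iff.1 hE r hr
  exact ⟨_, ht.toFinset, rfl, by simpa using h⟩

theorem coveringNumber_mono_set {E E' : Set α} (h : E ⊆ E') (hE : TotallyBounded E') {r : ℝ}
    (hr : 0 < r) : _root_.coveringNumber E r ≤ _root_.coveringNumber E' r := by
  obtain ⟨t, ht, h'⟩ := exists_card_eq_coveringNumber hE hr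
  exact ht ▸ coveringNumber_le_card (h.trans h')

theorem coveringNumber_anti_radius {E : Set α} (hE : TotallyBounded E) {r r' : ℝ}
    (hr : 0 < r) (hrr : r ≤ r') : _root_.coveringNumber E r' ≤ _root_.coveringNumber E r := by
  obtain ⟨t, ht, h'⟩ := exists_card_eq_coveringNumber hE hr
  exact ht ▸ coveringNumber_le_card
    (h'.trans (iUnion₂_mono fun x _ => ball_subset_ball hrr))

theorem one_le_coveringNumber {E : Set α} (hE : TotallyBounded E) (hne : E.Nonempty) {r : ℝ}
    (hr : 0 < r) : 1 ≤ _root_.coveringNumber E r := by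
  obtain ⟨t, ht, h'⟩ := exists_card_eq_coveringNumber hE hr
  rw [← ht, Nat.one_le_iff_ne_zero, Finset.card_ne_zero]
  obtain ⟨x, hx⟩ := hne
  obtain ⟨y, hy, -⟩ := mem_iUnion₂.1 (h' hx)
  exact ⟨y, hy⟩

/-- `log N_{e^{-x}}(E)`. -/
def logCov (E : Set α) (x : ℝ) : ℝ := Real.log (_root_.coveringNumber E (Real.exp (-x)))

theorem sFun_exp_neg (E : Set α) (x : ℝ) : sFun E (Real.exp (-x)) = logCov E x / x := by
  simp [sFun, logCov, Real.exp_neg]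

theorem map_exp_neg_atTop :
    map (fun x : ℝ => Real.exp (-x)) atTop = 𝓝[>] (0 : ℝ) := by
  have : (fun x : ℝ => Real.exp (-x)) = Real.exp ∘ Neg.neg := rfl
  rw [this, ← Filter.map_map, Filter.map_neg_atTop, Real.map_exp_atBot]

theorem dimLB_eq_liminf_logCov (E : Set α) :
    dimLB E = liminf (fun x => logCov E x / x) atTop := by
  simp_rw [dimLB, ← map_exp_neg_atTop, Filter.liminf, Filter.map_map, ← sFun_exp_neg]
  rfl

theorem dimUB_eq_limsup_logCov (E : Set α) :
    dimUB E = limsup (fun x => logCov E x / x) atTop := by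
  simp_rw [dimUB, ← map_exp_neg_atTop, Filter.limsup, Filter.map_map, ← sFun_exp_neg]
  rfl

theorem logCov_nonneg (E : Set α) (x : ℝ) : 0 ≤ logCov E x :=
  Real.log_natCast_nonneg _

theorem logCov_mono {E : Set α} (hE : TotallyBounded E) (hne : E.Nonempty) :
    Monotone (logCov E) := by
  intro x y hxy
  have h1 := one_le_coveringNumber hE hne (Real.exp_pos (-x))
  refine Real.log_le_log (by exact_mod_cast h1) ?_
  exact_mod_cast coveringNumber_anti_radius hE (Real.exp_pos (-y))
    (Real.exp_le_exp.2 (neg_le_neg hxy))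

theorem logCov_mono_set {E E' : Set α} (h : E ⊆ E') (hne : E.Nonempty) (hE : TotallyBounded E')
    (x : ℝ) : logCov E x ≤ logCov E' x := by
  have h1 := one_le_coveringNumber (hE.subset h) hne (Real.exp_pos (-x))
  refine Real.log_le_log (by exact_mod_cast h1) ?_
  exact_mod_cast coveringNumber_mono_set h hE (Real.exp_pos (-x))

end Covering

section Doubling

variable {d : ℕ}

theorem card_mul_le_of_separated {x : EuclideanSpace ℝ (Fin d)} {r r' : ℝ} (hr' : 0 < r')
    (hrr : r' ≤ r) {t : Finset (EuclideanSpace ℝ (Fin d))} (ht : ∀ y ∈ t, y ∈ ball x r)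
    (hsep : ∀ y ∈ t, ∀ z ∈ t, y ≠ z → r' ≤ dist y z) :
    (t.card : ℝ) ≤ (4 * (r / r')) ^ d := by
  have hr : 0 < r := hr'.trans_le hrr
  have hdisj : (t : Set (EuclideanSpace ℝ (Fin d))).PairwiseDisjoint fun y => ball y (r' / 2) := by
    intro y hy z hz hyz
    exact ball_disjoint_ball (by linarith [hsep y hy z hz hyz])
  have hsub : ⋃ y ∈ t, ball y (r' / 2) ⊆ ball x (2 * r) := by
    refine iUnion₂_subset fun y hy => ball_subset_ball' ?_
    have := mem_ball.1 (ht y hy)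
    linarith
  have h := measure_mono (μ := volume) hsub
  rw [measure_biUnion_finset hdisj fun _ _ => measurableSet_ball] at h
  set b := volume (ball (0 : EuclideanSpace ℝ (Fin d)) 1) with hb
  have hb0 : b ≠ 0 := (measure_ball_pos _ _ one_pos).ne'
  have hbt : b ≠ ⊤ := measure_ball_lt_top.ne
  rw [Finset.sum_congr rfl fun y _ =>
    Measure.addHaar_ball_of_pos volume y (half_pos hr'), Measure.addHaar_ball_of_pos volume x
      (by positivity : 0 < 2 * r), ← Finset.sum_mul] at h
  rw [ENNReal.mul_le_mul_iff_left hb0 hbt] at h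
  simp only [finrank_euclideanSpace, Fintype.card_fin, Finset.sum_const, nsmul_eq_mul] at h
  rw [← ENNReal.ofReal_natCast, ← ENNReal.ofReal_mul (by positivity),
    ENNReal.ofReal_le_ofReal_iff (by positivity)] at h
  rw [← le_div_iff₀ (by positivity), ← div_pow] at h
  have h4 : 4 * (r / r') = 2 * r / (r' / 2) := by field_simp; ring
  rwa [h4]

theorem exists_cover_ball (x : EuclideanSpace ℝ (Fin d)) {r r' : ℝ} (hr' : 0 < r')
    (hrr : r' ≤ r) : ∃ t : Finset (EuclideanSpace ℝ (Fin d)), (t.card : ℝ) ≤ (4 * (r / r')) ^ d ∧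
      ball x r ⊆ ⋃ y ∈ t, ball y r' := by
  classical
  let P : ℕ → Prop := fun n => ∃ t : Finset (EuclideanSpace ℝ (Fin d)), t.card = n ∧
    (∀ y ∈ t, y ∈ ball x r) ∧ ∀ y ∈ t, ∀ z ∈ t, y ≠ z → r' ≤ dist y z
  have hP0 : P 0 := ⟨∅, by simp⟩
  have hbd : ∀ n, P n → n ≤ ⌊(4 * (r / r')) ^ d⌋₊ := by
    rintro n ⟨t, rfl, h1, h2⟩
    exact Nat.le_floor (card_mul_le_of_separated hr' hrr h1 h2)
  obtain ⟨t, htc, h1, h2⟩ := Nat.findGreatest_spec (P := P) (Nat.zero_le _) hP0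
  refine ⟨t, card_mul_le_of_separated hr' hrr h1 h2, fun y hy => ?_⟩
  by_contra hcon
  simp only [mem_iUnion, mem_ball, not_exists, not_lt] at hcon
  have hyt : y ∉ t := fun h => by simpa using (hcon y h).trans_lt' hr'
  have hP : P (t.card + 1) := by
    refine ⟨insert y t, Finset.card_insert_of_notMem hyt, ?_, ?_⟩
    · simpa [Finset.forall_mem_insert] using ⟨hy, h1⟩
    · intro a ha b hb hab
      rw [Finset.mem_insert] at ha hb
      rcases ha with rfl | ha <;> rcases hb with rfl | hb
      · exact absurd rfl hab
      · exact hcon b hb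
      · rw [dist_comm]; exact hcon a ha
      · exact h2 a ha b hb hab
  have hle : t.card + 1 ≤ Nat.findGreatest P _ := Nat.le_findGreatest (hbd _ hP) hP
  rw [← htc] at hle
  omega

theorem coveringNumber_le_mul {E : Set (EuclideanSpace ℝ (Fin d))} (hE : TotallyBounded E)
    {r r' : ℝ} (hr' : 0 < r') (hrr : r' ≤ r) :
    (_root_.coveringNumber E r' : ℝ) ≤ (4 * (r / r')) ^ d * _root_.coveringNumber E r := by
  classical
  obtain ⟨t, ht, h⟩ := exists_card_eq_coveringNumber hE (hr'.trans_le hrr)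
  choose f hf hf' using fun x : EuclideanSpace ℝ (Fin d) => exists_cover_ball x hr' hrr
  have hcov : E ⊆ ⋃ y ∈ t.biUnion f, ball y r' := by
    intro x hx
    obtain ⟨y, hy, hxy⟩ := mem_iUnion₂.1 (h hx)
    obtain ⟨z, hz, hxz⟩ := mem_iUnion₂.1 (hf' y hxy)
    exact mem_iUnion₂.2 ⟨z, Finset.mem_biUnion.2 ⟨y, hy, hz⟩, hxz⟩
  calc (_root_.coveringNumber E r' : ℝ) ≤ (t.biUnion f).card := by
        exact_mod_cast coveringNumber_le_card hcov
    _ ≤ ∑ y ∈ t, ((f y).card : ℝ) := by exact_mod_cast Finset.card_biUnion_le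
    _ ≤ ∑ _y ∈ t, (4 * (r / r')) ^ d := Finset.sum_le_sum fun y _ => hf y
    _ = _ := by rw [Finset.sum_const, nsmul_eq_mul, ht, mul_comm]

theorem logCov_le_add {E : Set (EuclideanSpace ℝ (Fin d))} (hE : TotallyBounded E)
    (hne : E.Nonempty) {x y : ℝ} (hxy : x ≤ y) :
    logCov E y ≤ logCov E x + d * (y - x) + d * Real.log 4 := by
  have h := coveringNumber_le_mul hE (Real.exp_pos (-y)) (Real.exp_le_exp.2 (neg_le_neg hxy))
  have h1 := one_le_coveringNumber hE hne (Real.exp_pos (-x))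
  have h2 := one_le_coveringNumber hE hne (Real.exp_pos (-y))
  rw [← Real.exp_sub] at h
  have := Real.log_le_log (by exact_mod_cast h2) h
  rw [Real.log_mul (by positivity) (by positivity), Real.log_pow,
    Real.log_mul (by positivity) (by positivity), Real.log_exp] at this
  unfold logCov
  linarith

theorem eventually_logCov_div_le {E : Set (EuclideanSpace ℝ (Fin d))} (hE : TotallyBounded E)
    (hne : E.Nonempty) {ε : ℝ} (hε : 0 < ε) : ∀ᶠ x in atTop, logCov E x / x ≤ d + ε := by
  filter_upwards [eventually_gt_atTop 0,
    eventually_ge_atTop ((logCov E 0 + d * Real.log 4) / ε)] with x hx hx'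
  rw [div_le_iff₀ hx]
  rw [div_le_iff₀ hε] at hx'
  have := logCov_le_add hE hne hx.le
  linarith

theorem isBoundedUnder_le_logCov_div {E : Set (EuclideanSpace ℝ (Fin d))} (hE : TotallyBounded E)
    (hne : E.Nonempty) : IsBoundedUnder (· ≤ ·) atTop fun x => logCov E x / x :=
  isBoundedUnder_of_eventually_le (eventually_logCov_div_le hE hne one_pos)

theorem isBoundedUnder_ge_logCov_div {α : Type*} [PseudoMetricSpace α] (E : Set α) :
    IsBoundedUnder (· ≥ ·) atTop fun x => logCov E x / x := by
  refine isBoundedUnder_of_eventually_ge (a := 0) ?_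
  filter_upwards [eventually_gt_atTop 0] with x hx
  exact div_nonneg (logCov_nonneg E x) hx.le

variable {E : Set (EuclideanSpace ℝ (Fin d))}

theorem dimUB_le_dim (hE : TotallyBounded E) (hne : E.Nonempty) : dimUB E ≤ d := by
  rw [dimUB_eq_limsup_logCov]
  exact le_of_forall_pos_le_add fun ε hε => limsup_le_of_le
    (isBoundedUnder_ge_logCov_div E).isCoboundedUnder_le (eventually_logCov_div_le hE hne hε)

theorem dimLB_le_dimUB (hE : TotallyBounded E) (hne : E.Nonempty) : dimLB E ≤ dimUB E := by
  rw [dimUB_eq_limsup_logCov, dimLB_eq_liminf_logCov]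
  exact liminf_le_limsup (isBoundedUnder_le_logCov_div hE hne) (isBoundedUnder_ge_logCov_div E)

theorem dimLB_nonneg (hE : TotallyBounded E) (hne : E.Nonempty) : 0 ≤ dimLB E := by
  rw [dimLB_eq_liminf_logCov]
  refine le_liminf_of_le (isBoundedUnder_le_logCov_div hE hne).isCoboundedUnder_ge ?_
  filter_upwards [eventually_gt_atTop 0] with x hx
  exact div_nonneg (logCov_nonneg E x) hx.le

theorem dimLB_mono {E' : Set (EuclideanSpace ℝ (Fin d))} (h : E ⊆ E') (hE : TotallyBounded E')
    (hne : E.Nonempty) : dimLB E ≤ dimLB E' := by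
  rw [dimLB_eq_liminf_logCov, dimLB_eq_liminf_logCov]
  refine liminf_le_liminf ?_ (isBoundedUnder_ge_logCov_div E)
    (isBoundedUnder_le_logCov_div hE (hne.mono h)).isCoboundedUnder_ge
  filter_upwards [eventually_gt_atTop 0] with x hx
  exact div_le_div_of_nonneg_right (logCov_mono_set h hne hE x) hx.le

theorem eventually_logCov_le_of_dimUB_lt (hE : TotallyBounded E) (hne : E.Nonempty) {t : ℝ}
    (ht : dimUB E < t) : ∀ᶠ x in atTop, logCov E x ≤ t * x := by
  rw [dimUB_eq_limsup_logCov] at ht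
  filter_upwards [eventually_lt_of_limsup_lt ht (isBoundedUnder_le_logCov_div hE hne),
    eventually_gt_atTop 0] with x hx hx0
  exact ((div_lt_iff₀ hx0).1 hx).le

theorem frequently_logCov_le_of_dimLB_lt (hE : TotallyBounded E) (hne : E.Nonempty) {t : ℝ}
    (ht : dimLB E < t) : ∃ᶠ x in atTop, logCov E x ≤ t * x := by
  rw [dimLB_eq_liminf_logCov] at ht
  refine ((frequently_lt_of_liminf_lt
    (isBoundedUnder_le_logCov_div hE hne).isCoboundedUnder_ge ht).and_eventually
    (eventually_gt_atTop 0)).mono fun x hx => ((div_lt_iff₀ hx.2).1 hx.1).le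

theorem dimLB_le_of_frequently {t : ℝ} (h : ∃ᶠ x in atTop, logCov E x ≤ t * x) :
    dimLB E ≤ t := by
  rw [dimLB_eq_liminf_logCov]
  refine liminf_le_of_frequently_le ?_ (isBoundedUnder_ge_logCov_div E)
  exact (h.and_eventually (eventually_gt_atTop 0)).mono fun x hx => (div_le_iff₀ hx.2).2 hx.1

theorem dimH_le_dimLB (hE : TotallyBounded E) (hne : E.Nonempty) :
    dimH E ≤ ENNReal.ofReal (dimLB E) := by
  refine le_of_forall_gt_imp_ge_of_dense fun s hs => ?_
  induction s with
  | top => exact le_top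
  | coe s =>
  have hs' : dimLB E < s := by
    rw [← ENNReal.ofReal_coe_nnreal] at hs
    exact (ENNReal.ofReal_lt_ofReal_iff_of_nonneg (dimLB_nonneg hE hne)).1 hs
  have hfreq := frequently_logCov_le_of_dimLB_lt hE hne hs'
  choose t htc ht using fun x : ℝ => exists_card_eq_coveringNumber hE (Real.exp_pos (-x))
  set l : Filter ℝ := atTop ⊓ 𝓟 {x | logCov E x ≤ s * x} with hl
  have : l.NeBot := frequently_mem_iff_neBot.1 hfreq
  have hr : Tendsto (fun x : ℝ => 2 * ENNReal.ofReal (Real.exp (-x))) l (𝓝 0) := by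
    have h1 := (ENNReal.tendsto_ofReal (Real.tendsto_exp_neg_atTop_nhds_zero)).mono_left
      (inf_le_left : l ≤ atTop)
    simpa using ENNReal.Tendsto.const_mul (a := 2) h1 (Or.inr ENNReal.ofNat_ne_top)
  have hdiam : ∀ x : ℝ, ∀ y : EuclideanSpace ℝ (Fin d),
      ediam (ball y (Real.exp (-x))) ≤ 2 * ENNReal.ofReal (Real.exp (-x)) := by
    intro x y
    rw [← Metric.eball_ofReal]
    exact ediam_eball_le
  have hmeas := Measure.hausdorffMeasure_le_liminf_sum (ι := fun x : ℝ => t x) (s : ℝ) E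
    (l := l) _ hr (fun x y => ball y (Real.exp (-x)))
    (Eventually.of_forall fun x y => hdiam x y)
    (Eventually.of_forall fun x y hy => by
      obtain ⟨z, hz, hyz⟩ := mem_iUnion₂.1 (ht x hy)
      exact mem_iUnion.2 ⟨⟨z, hz⟩, hyz⟩)
  refine dimH_le_of_hausdorffMeasure_ne_top (ne_top_of_le_ne_top ?_ (hmeas.trans
    (b := liminf (fun x : ℝ => ∑ y : t x, ediam (ball (y : EuclideanSpace ℝ (Fin d))
      (Real.exp (-x))) ^ (s : ℝ)) l) (c := ENNReal.ofReal (2 ^ (s : ℝ))) ?_))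
  · exact ENNReal.ofReal_ne_top
  refine (liminf_le_liminf (v := fun _ => ENNReal.ofReal (2 ^ (s : ℝ))) ?_).trans_eq
    (liminf_const _)
  have hmem : ∀ᶠ x in l, logCov E x ≤ s * x := mem_inf_of_right (mem_principal_self _)
  filter_upwards [hmem] with x hx
  have h1 : (0 : ℝ) < _root_.coveringNumber E (Real.exp (-x)) := by
    exact_mod_cast one_le_coveringNumber hE hne (Real.exp_pos (-x))
  have h2 : (_root_.coveringNumber E (Real.exp (-x)) : ℝ) ≤ Real.exp (s * x) :=
    (Real.log_le_iff_le_exp h1).1 hx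
  calc ∑ y : t x, ediam (ball (y : EuclideanSpace ℝ (Fin d)) (Real.exp (-x))) ^ (s : ℝ)
      ≤ ∑ _y : t x, (2 * ENNReal.ofReal (Real.exp (-x))) ^ (s : ℝ) :=
        Finset.sum_le_sum fun y _ => ENNReal.rpow_le_rpow (hdiam x y) s.2
    _ = ENNReal.ofReal (_root_.coveringNumber E (Real.exp (-x)) *
          (2 * Real.exp (-x)) ^ (s : ℝ)) := by
        rw [Finset.sum_const, nsmul_eq_mul, Finset.card_univ, Fintype.card_coe, htc,
          ENNReal.ofReal_mul (by positivity), ENNReal.ofReal_natCast,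
          ← ENNReal.ofReal_rpow_of_nonneg (by positivity : 0 ≤ 2 * Real.exp (-x)) s.coe_nonneg,
          ENNReal.ofReal_mul zero_le_two, ENNReal.ofReal_ofNat]
    _ ≤ ENNReal.ofReal (Real.exp (s * x) * (2 * Real.exp (-x)) ^ (s : ℝ)) := by gcongr
    _ = ENNReal.ofReal (2 ^ (s : ℝ)) := by
        rw [Real.mul_rpow zero_le_two (Real.exp_pos _).le, ← Real.exp_mul, mul_left_comm,
          ← Real.exp_add]
        simp [mul_comm]

end Doubling

section GrowthAnalysis

variable {G L : ℝ → ℝ} {h s t α a C₀ : ℝ}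

theorem exists_le_mul_add_of_eventually (hG : Monotone G) (hG0 : ∀ x, 0 ≤ G x) (ht : 0 ≤ t)
    (hev : ∀ᶠ x in atTop, G x ≤ t * x) : ∃ C, 0 ≤ C ∧ ∀ y, 0 ≤ y → G y ≤ t * y + C := by
  obtain ⟨Y, hY⟩ := eventually_atTop.1 hev
  refine ⟨G Y, hG0 Y, fun y hy => ?_⟩
  rcases le_total Y y with h | h
  · linarith [hY y h, hG0 Y]
  · linarith [hG h, mul_nonneg ht hy]

theorem frequently_le_of_forall_exists {b : ℝ} {ε C : ℝ} (hε : 0 < ε)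
    (H : ∀ N, ∃ x, N ≤ x ∧ L (x - a) ≤ C + b * x) : ∃ᶠ x in atTop, L x ≤ (b + ε) * x := by
  refine frequently_atTop.2 fun N => ?_
  obtain ⟨x, hx, hLx⟩ := H (max N ((C + b * a) / ε) + a)
  have h1 : N ≤ x - a := by linarith [le_max_left N ((C + b * a) / ε)]
  have h2 : (C + b * a) / ε ≤ x - a := by linarith [le_max_right N ((C + b * a) / ε)]
  rw [div_le_iff₀ hε] at h2
  exact ⟨x - a, h1, by linarith⟩

/-- If `L(x - a) ≤ sup_{y ≤ x} (h'(x - y) + G(y)) + O(1)` for all `h' > h`, then `L` grows at rate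
at most `h` provided that `G` does. -/
theorem frequently_le_of_le_rate (hG : Monotone G) (hG0 : ∀ x, 0 ≤ G x) (hh : 0 ≤ h)
    (ht : ∀ t' > t, ∀ᶠ x in atTop, G x ≤ t' * x)
    (hL : ∀ h' > h, ∃ C, ∀ x ≥ 0, ∀ B, (∀ y ∈ Icc 0 x, h' * (x - y) + G y ≤ B) →
      L (x - a) ≤ C + B)
    (hth : t ≤ h) {ε : ℝ} (hε : 0 < ε) : ∃ᶠ x in atTop, L x ≤ (h + ε) * x := by
  obtain ⟨C₁, hC₁, hG₁⟩ := exists_le_mul_add_of_eventually hG hG0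
    (by linarith : 0 ≤ h + ε / 2) (ht (h + ε / 2) (by linarith))
  obtain ⟨C, hC⟩ := hL (h + ε / 2) (by linarith)
  have := frequently_le_of_forall_exists (L := L) (a := a) (b := h + ε / 2) (C := C + C₁)
    (half_pos hε) fun N => ⟨max N 0, le_max_left _ _, ?_⟩
  · simpa [add_assoc] using this
  · have := hC (max N 0) (le_max_right _ _) ((h + ε / 2) * max N 0 + C₁) fun y hy => by
      linarith [hG₁ y hy.1]
    linarith

/-- If `L(x - a) ≤ sup_{y ≤ x} (h'(x - y) + G(y)) + O(1)` for all `h' > h`, then the lower rate of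
`L` is controlled by the lower and upper rates of `G`. -/
theorem frequently_le_of_rate_lt (hG : Monotone G) (hG0 : ∀ x, 0 ≤ G x)
    (hgrow : ∀ x y, x ≤ y → G y ≤ G x + α * (y - x) + C₀) (hh : 0 ≤ h)
    (hs0 : 0 ≤ s) (hst : s ≤ t) (htα : t ≤ α)
    (hs : ∀ s' > s, ∃ᶠ x in atTop, G x ≤ s' * x)
    (ht : ∀ t' > t, ∀ᶠ x in atTop, G x ≤ t' * x)
    (hL : ∀ h' > h, ∃ C, ∀ x ≥ 0, ∀ B, (∀ y ∈ Icc 0 x, h' * (x - y) + G y ≤ B) →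
      L (x - a) ≤ C + B)
    (hht : h < t) {ε : ℝ} (hε : 0 < ε) :
    ∃ᶠ x in atTop, L x ≤ (h + (t - h) * (α - h) * s / (α * t - h * s) + ε) * x := by
  set β := h + (t - h) * (α - h) * s / (α * t - h * s) with hβ
  have ht0 : 0 < t := hh.trans_lt hht
  have hαh : 0 < α - h := by linarith
  have hD : 0 < α * t - h * s := by nlinarith
  have hC₀ : 0 ≤ C₀ := by linarith [hgrow 0 0 le_rfl]
  set A := (α * t - h * s) / (t * (α - h)) with hA
  have hA1 : 1 ≤ A := by
    rw [hA, le_div_iff₀ (by positivity)]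
    nlinarith
  have hβA : β * A = h * A + (t - h) * s / t := by
    have hD' : t * α - h * s ≠ 0 := by linarith
    rw [hβ, hA]
    field_simp
  have hβA' : β * A = s + α * (A - 1) := by
    rw [hβA, hA]
    field_simp
    ring
  set η := ε / 4 with hη
  have hη0 : 0 < η := by positivity
  obtain ⟨C₁, hC₁, hG₁⟩ := exists_le_mul_add_of_eventually hG hG0
    (by linarith : 0 ≤ t + η) (ht (t + η) (by linarith))
  obtain ⟨C, hC⟩ := hL (h + η) (by linarith)
  have key := frequently_le_of_forall_exists (L := L) (a := a) (b := β + 3 * η) (ε := η)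
    (C := C + C₁ + C₀) hη0 fun N => ?_
  · have : β + 3 * η + η = β + ε := by rw [hη]; ring
    rwa [this] at key
  obtain ⟨x₀, hx₀, hGx₀⟩ := frequently_atTop.1 (hs (s + η) (by linarith)) (max N 0)
  have hx₀0 : 0 ≤ x₀ := (le_max_right _ _).trans hx₀
  have hx₀x : x₀ ≤ A * x₀ := le_mul_of_one_le_left hx₀0 hA1
  refine ⟨A * x₀, ((le_max_left _ _).trans hx₀).trans hx₀x, ?_⟩
  set x := A * x₀ with hx
  have e1 : β * x = h * x + (t - h) * s / t * x₀ := by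
    rw [hx, ← mul_assoc, hβA]; ring
  have e2 : β * x = s * x₀ + α * (x - x₀) := by
    rw [hx, ← mul_assoc, hβA']; ring
  have := hC x (hx₀0.trans hx₀x) (β * x + 3 * η * x + C₁ + C₀) fun y hy => ?_
  · linarith
  rcases le_total y x₀ with hyx | hyx
  · have g1 := hG₁ y hy.1
    have g2 := (hG hyx).trans hGx₀
    have hl0 : 0 ≤ h / t := by positivity
    have hl1 : h / t ≤ 1 := (div_le_one ht0).2 hht.le
    have g3 : G y ≤ h / t * ((t + η) * y + C₁) + (1 - h / t) * ((s + η) * x₀) := by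
      have a1 := mul_le_mul_of_nonneg_left g1 hl0
      have a2 := mul_le_mul_of_nonneg_left g2 (sub_nonneg.2 hl1)
      linarith
    have g4 : h / t * ((t + η) * y + C₁) + (1 - h / t) * ((s + η) * x₀) =
        h * y + (t - h) * s / t * x₀ + h / t * (η * y) + h / t * C₁ +
          (1 - h / t) * (η * x₀) := by
      field_simp
      ring
    have b1 : h / t * (η * y) ≤ η * y := mul_le_of_le_one_left (mul_nonneg hη0.le hy.1) hl1
    have b2 : h / t * C₁ ≤ C₁ := mul_le_of_le_one_left hC₁ hl1
    have b3 : (1 - h / t) * (η * x₀) ≤ η * x₀ :=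
      mul_le_of_le_one_left (mul_nonneg hη0.le hx₀0) (by linarith)
    have b4 : η * x₀ ≤ η * x := mul_le_mul_of_nonneg_left hx₀x hη0.le
    have b5 : 0 ≤ η * x := mul_nonneg hη0.le (hx₀0.trans hx₀x)
    linarith
  · have g1 := hgrow x₀ y hyx
    have g2 : (h + η) * (x - y) ≤ α * (x - y) + η * x := by
      have c1 : h * (x - y) ≤ α * (x - y) :=
        mul_le_mul_of_nonneg_right (by linarith) (by linarith [hy.2])
      have c2 : 0 ≤ η * y := mul_nonneg hη0.le hy.1
      linarith
    have b4 : η * x₀ ≤ η * x := mul_le_mul_of_nonneg_left hx₀x hη0.le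
    have b5 : 0 ≤ η * x := mul_nonneg hη0.le (hx₀0.trans hx₀x)
    linarith

end GrowthAnalysis

section Conformal

variable {d : ℕ}

theorem IsConformalMap.norm_apply_eq [NeZero d]
    {A : EuclideanSpace ℝ (Fin d) →L[ℝ] EuclideanSpace ℝ (Fin d)} (hA : IsConformalMap A)
    (v : EuclideanSpace ℝ (Fin d)) : ‖A v‖ = ‖A‖ * ‖v‖ := by
  obtain ⟨a, -, li, rfl⟩ := hA
  rw [norm_smul, LinearIsometry.norm_toContinuousLinearMap]
  simp [norm_smul]

theorem IsConformalMap.norm_pos [NeZero d]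
    {A : EuclideanSpace ℝ (Fin d) →L[ℝ] EuclideanSpace ℝ (Fin d)} (hA : IsConformalMap A) :
    0 < ‖A‖ := by
  obtain ⟨a, ha, li, rfl⟩ := hA
  rw [norm_smul, LinearIsometry.norm_toContinuousLinearMap, mul_one]
  exact norm_pos_iff.2 ha

theorem IsConformalMap.norm_comp [NeZero d]
    {A B : EuclideanSpace ℝ (Fin d) →L[ℝ] EuclideanSpace ℝ (Fin d)} (hA : IsConformalMap A) :
    ‖A.comp B‖ = ‖A‖ * ‖B‖ := by
  refine le_antisymm (A.opNorm_comp_le B) ?_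
  rw [← le_div_iff₀' hA.norm_pos]
  refine B.opNorm_le_bound (by positivity) fun v => ?_
  rw [div_mul_eq_mul_div, le_div_iff₀' hA.norm_pos, ← hA.norm_apply_eq]
  exact (A.comp B).le_opNorm v

theorem IsConformalMap.abs_det_eq [NeZero d]
    {A : EuclideanSpace ℝ (Fin d) →L[ℝ] EuclideanSpace ℝ (Fin d)} (hA : IsConformalMap A) :
    |A.det| = ‖A‖ ^ d := by
  obtain ⟨a, -, li, rfl⟩ := hA
  rw [norm_smul, LinearIsometry.norm_toContinuousLinearMap, mul_one]
  have : (a • li.toContinuousLinearMap).det = LinearMap.det (a • li.toLinearMap) := rfl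
  rw [this, ← LinearMap.normDet_eq_abs_det, LinearMap.normDet_smul, li.normDet_eq_one]
  simp

end Conformal

section Words

variable {α I : Type*} {T : I → α → α} {s : Set α}

theorem compMaps_append (T : I → α → α) (u v : List I) :
    compMaps T (u ++ v) = compMaps T u ∘ compMaps T v := by
  induction u with
  | nil => rfl
  | cons i u ih => simp [compMaps, ih, Function.comp_assoc]

theorem compMaps_singleton (T : I → α → α) (i : I) : compMaps T [i] = T i := rfl

theorem compMaps_flatten (T : I → α → α) (W : List (List I)) :
    compMaps (compMaps T) W = compMaps T W.flatten := by
  induction W with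
  | nil => rfl
  | cons w W ih => simp [compMaps, ih, compMaps_append]

theorem compMaps_map {J : Type*} (f : J → I) (T : I → α → α) (w : List J) :
    compMaps (fun j => T (f j)) w = compMaps T (w.map f) := by
  induction w with
  | nil => rfl
  | cons w W ih => simp [compMaps, ih]

theorem mapsTo_compMaps (h : ∀ i, MapsTo (T i) s s) (u : List I) : MapsTo (compMaps T u) s s := by
  induction u with
  | nil => exact mapsTo_id s
  | cons i u ih => exact (h i).comp ih

theorem injOn_compMaps (h : ∀ i, MapsTo (T i) s s) (h' : ∀ i, InjOn (T i) s) (u : List I) :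
    InjOn (compMaps T u) s := by
  induction u with
  | nil => exact injOn_id s
  | cons i u ih => exact (h' i).comp ih (mapsTo_compMaps h u)

theorem compMaps_eqOn {T' : I → α → α} (h : ∀ i, MapsTo (T i) s s) (h' : ∀ i, EqOn (T' i) (T i) s)
    (u : List I) : EqOn (compMaps T' u) (compMaps T u) s := by
  induction u with
  | nil => exact eqOn_refl _ _
  | cons i u ih =>
    intro x hx
    simp [compMaps, ih hx, h' i (mapsTo_compMaps h u hx)]

/-- The limit set of a family of maps `T` with seed set `s`. -/
def limitSetOf (T : I → α → α) (s : Set α) : Set α :=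
  ⋃ γ : ℕ → I, ⋂ n : ℕ, compMaps T (List.ofFn fun k : Fin (n + 1) => γ k) '' s

theorem mem_limitSetOf (h : ∀ i, MapsTo (T i) s s) {x : α} :
    x ∈ limitSetOf T s ↔
      ∃ γ : ℕ → I, ∀ n : ℕ, x ∈ compMaps T (List.ofFn fun k : Fin n => γ k) '' s := by
  simp only [limitSetOf, mem_iUnion, mem_iInter]
  refine exists_congr fun γ => ⟨fun hx n => ?_, fun hx n => hx (n + 1)⟩
  cases n with
  | zero =>
    obtain ⟨y, hy, rfl⟩ := hx 0
    refine ⟨_, mapsTo_compMaps h (List.ofFn fun k : Fin (0 + 1) => γ k) hy, ?_⟩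
    rw [List.ofFn_zero]
    rfl
  | succ n => exact hx n

theorem limitSetOf_subset (h : ∀ i, MapsTo (T i) s s) : limitSetOf T s ⊆ s := by
  intro x hx
  obtain ⟨γ, hγ⟩ := (mem_limitSetOf h).1 hx
  simpa [compMaps] using hγ 0

theorem limitSetOf_subset_iUnion_image (h : ∀ i, MapsTo (T i) s s) (h' : ∀ i, InjOn (T i) s) :
    limitSetOf T s ⊆ ⋃ i, T i '' limitSetOf T s := by
  intro x hx
  obtain ⟨γ, hγ⟩ := (mem_limitSetOf h).1 hx
  have hstep : ∀ n, compMaps T (List.ofFn fun k : Fin (n + 1) => γ k) =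
      T (γ 0) ∘ compMaps T (List.ofFn fun k : Fin n => γ (k + 1)) := by
    intro n
    rw [List.ofFn_succ]
    rfl
  obtain ⟨y, hy, rfl⟩ := hγ 1
  rw [hstep] at hγ ⊢
  refine mem_iUnion.2 ⟨γ 0, _, (mem_limitSetOf h).2 ⟨fun k => γ (k + 1), fun n => ?_⟩, rfl⟩
  obtain ⟨z, hz, hzy⟩ := hγ (n + 1)
  rw [hstep] at hzy
  exact ⟨z, hz, h' _ (mapsTo_compMaps h _ hz) (mapsTo_compMaps h _ hy) hzy⟩

theorem subset_limitSetOf (h : ∀ i, MapsTo (T i) s s) {A : Set α} (hA : A ⊆ s)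
    (hself : A ⊆ ⋃ i, T i '' A) : A ⊆ limitSetOf T s := by
  intro x hx
  have : ∀ y : A, ∃ p : I × A, T p.1 p.2 = y := fun y => by
    obtain ⟨i, z, hz, hzy⟩ := mem_iUnion.1 (hself y.2)
    exact ⟨(i, ⟨z, hz⟩), hzy⟩
  choose f hf using this
  let g : A → A := fun y => (f y).2
  have key : ∀ n (y : A), compMaps T (List.ofFn fun k : Fin n => (f (g^[k] y)).1) (g^[n] y) = y := by
    intro n
    induction n with
    | zero => exact fun y => rfl
    | succ n ih =>
      intro y
      rw [List.ofFn_succ]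
      simp only [compMaps, Function.comp_apply, Fin.val_zero, Function.iterate_zero, id_eq,
        Fin.val_succ, Function.iterate_succ_apply]
      rw [ih (g y)]
      exact hf y
  exact (mem_limitSetOf h).2 ⟨fun n => (f (g^[n] ⟨x, hx⟩)).1, fun n =>
    ⟨g^[n] ⟨x, hx⟩, hA (g^[n] ⟨x, hx⟩).2, key n ⟨x, hx⟩⟩⟩

/-- Passing to a family of nonempty words shrinks the limit set. -/
theorem limitSetOf_words_subset (h : ∀ i, MapsTo (T i) s s) (h' : ∀ i, InjOn (T i) s)
    {J : Type*} (f : J → List I) (hf : ∀ j, f j ≠ []) :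
    limitSetOf (fun j => compMaps T (f j)) s ⊆ limitSetOf T s := by
  set B := limitSetOf (fun j => compMaps T (f j)) s with hB
  have hB1 : B ⊆ s := limitSetOf_subset fun j => mapsTo_compMaps h (f j)
  have hB2 : B ⊆ ⋃ j, compMaps T (f j) '' B := limitSetOf_subset_iUnion_image
    (fun j => mapsTo_compMaps h (f j)) fun j => injOn_compMaps h h' (f j)
  have hBA : B ⊆ ⋃ v : List I, compMaps T v '' B :=
    fun x hx => mem_iUnion.2 ⟨[], x, hx, rfl⟩
  refine hBA.trans (subset_limitSetOf h ?_ ?_)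
  · refine iUnion_subset fun v => ?_
    rintro _ ⟨x, hx, rfl⟩
    exact mapsTo_compMaps h v (hB1 hx)
  · have key : ∀ (v : List I), v ≠ [] → ∀ x ∈ B,
        compMaps T v x ∈ ⋃ i, T i '' ⋃ v : List I, compMaps T v '' B := by
      intro v hv x hx
      cases v with
      | nil => exact absurd rfl hv
      | cons i v => exact mem_iUnion.2 ⟨i, _, mem_iUnion.2 ⟨v, x, hx, rfl⟩, rfl⟩
    refine iUnion_subset fun v => ?_
    rintro _ ⟨x, hx, rfl⟩
    by_cases hv : v = []
    · subst hv
      obtain ⟨j, y, hy, hyx⟩ := mem_iUnion.1 (hB2 hx)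
      change x ∈ _
      rw [← hyx]
      exact key _ (hf j) y hy
    · exact key v hv x hx

end Words

/-- A system of conformal contractions with bounded distortion and the open set condition: the
features of a `CIFS` that are inherited by families of words. -/
structure ConformalSystem (d : ℕ) (J : Type*) where
  /-- the seed set -/
  X : Set (EuclideanSpace ℝ (Fin d))
  /-- the domain of conformality -/
  V : Set (EuclideanSpace ℝ (Fin d))
  /-- the maps -/
  T : J → EuclideanSpace ℝ (Fin d) → EuclideanSpace ℝ (Fin d)
  /-- the contraction ratio -/
  c : ℝ
  /-- the distortion constant -/
  K : ℝ
  isCompact_X : IsCompact X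
  isPreconnected_X : IsPreconnected X
  nonempty_interior : (interior X).Nonempty
  isOpen_V : IsOpen V
  X_subset_V : X ⊆ V
  mapsTo_X : ∀ j, MapsTo (T j) X X
  c_pos : 0 < c
  c_lt_one : c < 1
  dist_le : ∀ j, ∀ x ∈ X, ∀ y ∈ X, dist (T j x) (T j y) ≤ c * dist x y
  mapsTo_V : ∀ j, MapsTo (T j) V V
  injOn_V : ∀ j, InjOn (T j) V
  differentiableOn_V : ∀ j, DifferentiableOn ℝ (T j) V
  conformal : ∀ j, ∀ x ∈ V, IsConformalMap (fderiv ℝ (T j) x)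
  one_le_K : 1 ≤ K
  distortion : ∀ w : List J, ∀ x ∈ V, ∀ y ∈ V,
    ‖fderiv ℝ (compMaps T w) x‖ ≤ K * ‖fderiv ℝ (compMaps T w) y‖
  image_interior_subset : ∀ j, T j '' interior X ⊆ interior X
  disjoint_image_interior : ∀ i j, i ≠ j → Disjoint (T i '' interior X) (T j '' interior X)

namespace ConformalSystem

variable {d : ℕ} {J : Type*} (Φ : ConformalSystem d J)

theorem mapsTo_X_word (u : List J) : MapsTo (compMaps Φ.T u) Φ.X Φ.X :=
  mapsTo_compMaps Φ.mapsTo_X u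

theorem mapsTo_V_word (u : List J) : MapsTo (compMaps Φ.T u) Φ.V Φ.V :=
  mapsTo_compMaps Φ.mapsTo_V u

theorem mapsTo_interior_word (u : List J) :
    MapsTo (compMaps Φ.T u) (interior Φ.X) (interior Φ.X) :=
  mapsTo_compMaps (fun j => mapsTo_iff_image_subset.2 (Φ.image_interior_subset j)) u

theorem injOn_V_word (u : List J) : InjOn (compMaps Φ.T u) Φ.V :=
  injOn_compMaps Φ.mapsTo_V Φ.injOn_V u

theorem interior_subset_V : interior Φ.X ⊆ Φ.V := interior_subset.trans Φ.X_subset_V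

theorem differentiableOn_V_word (u : List J) : DifferentiableOn ℝ (compMaps Φ.T u) Φ.V := by
  induction u with
  | nil => exact differentiableOn_id
  | cons i u ih => exact (Φ.differentiableOn_V i).comp ih (Φ.mapsTo_V_word u)

theorem differentiableAt_word (u : List J) {x : EuclideanSpace ℝ (Fin d)} (hx : x ∈ Φ.V) :
    DifferentiableAt ℝ (compMaps Φ.T u) x :=
  (Φ.differentiableOn_V_word u).differentiableAt (Φ.isOpen_V.mem_nhds hx)

theorem fderiv_append (u v : List J) {x : EuclideanSpace ℝ (Fin d)} (hx : x ∈ Φ.V) :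
    fderiv ℝ (compMaps Φ.T (u ++ v)) x =
      (fderiv ℝ (compMaps Φ.T u) (compMaps Φ.T v x)).comp (fderiv ℝ (compMaps Φ.T v) x) := by
  rw [compMaps_append]
  exact fderiv_comp x (Φ.differentiableAt_word u (Φ.mapsTo_V_word v hx))
    (Φ.differentiableAt_word v hx)

theorem conformal_word (u : List J) {x : EuclideanSpace ℝ (Fin d)} (hx : x ∈ Φ.V) :
    IsConformalMap (fderiv ℝ (compMaps Φ.T u) x) := by
  induction u with
  | nil => simpa [compMaps] using isConformalMap_id
  | cons i u ih =>
    rw [← List.singleton_append, Φ.fderiv_append [i] u hx]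
    exact (Φ.conformal i _ (Φ.mapsTo_V_word u hx)).comp ih

theorem dist_word_le (u : List J) {x y : EuclideanSpace ℝ (Fin d)} (hx : x ∈ Φ.X) (hy : y ∈ Φ.X) :
    dist (compMaps Φ.T u x) (compMaps Φ.T u y) ≤ Φ.c ^ u.length * dist x y := by
  induction u with
  | nil => simp [compMaps]
  | cons i u ih =>
    refine (Φ.dist_le i _ (Φ.mapsTo_X_word u hx) _ (Φ.mapsTo_X_word u hy)).trans ?_
    rw [List.length_cons, pow_succ', mul_assoc]
    exact mul_le_mul_of_nonneg_left ih Φ.c_pos.le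

/-- A point of the interior of the seed set. -/
def base : EuclideanSpace ℝ (Fin d) := Φ.nonempty_interior.some

theorem base_mem_interior : Φ.base ∈ interior Φ.X := Φ.nonempty_interior.some_mem

theorem base_mem_X : Φ.base ∈ Φ.X := interior_subset Φ.base_mem_interior

theorem base_mem_V : Φ.base ∈ Φ.V := Φ.X_subset_V Φ.base_mem_X

/-- The contraction ratio of a word at the base point. -/
def ratio (u : List J) : ℝ := ‖fderiv ℝ (compMaps Φ.T u) Φ.base‖

theorem ratio_pos [NeZero d] (u : List J) : 0 < Φ.ratio u :=
  (Φ.conformal_word u Φ.base_mem_V).norm_pos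

theorem ratio_nil [NeZero d] : Φ.ratio [] = 1 := by
  simp [ratio, compMaps]

theorem K_pos : 0 < Φ.K := one_pos.trans_le Φ.one_le_K

theorem norm_fderiv_le (u : List J) {x : EuclideanSpace ℝ (Fin d)} (hx : x ∈ Φ.V) :
    ‖fderiv ℝ (compMaps Φ.T u) x‖ ≤ Φ.K * Φ.ratio u :=
  Φ.distortion u x hx _ Φ.base_mem_V

theorem ratio_div_le_norm_fderiv (u : List J) {x : EuclideanSpace ℝ (Fin d)} (hx : x ∈ Φ.V) :
    Φ.ratio u / Φ.K ≤ ‖fderiv ℝ (compMaps Φ.T u) x‖ :=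
  (div_le_iff₀' Φ.K_pos).2 (Φ.distortion u _ Φ.base_mem_V x hx)

theorem ratio_le_pow (u : List J) : Φ.ratio u ≤ Φ.c ^ u.length := by
  have h0 : 0 ≤ Φ.c ^ u.length := pow_nonneg Φ.c_pos.le _
  refine norm_fderiv_le_of_lipschitzOn ℝ (mem_interior_iff_mem_nhds.1 Φ.base_mem_interior)
    (C := ⟨_, h0⟩) (LipschitzOnWith.of_dist_le_mul fun x hx y hy => Φ.dist_word_le u hx hy)

theorem ratio_append [NeZero d] (u v : List J) : Φ.ratio (u ++ v) =
    ‖fderiv ℝ (compMaps Φ.T u) (compMaps Φ.T v Φ.base)‖ * Φ.ratio v := by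
  rw [ratio, Φ.fderiv_append u v Φ.base_mem_V,
    (Φ.conformal_word u (Φ.mapsTo_V_word v Φ.base_mem_V)).norm_comp, ratio]

theorem le_ratio_append [NeZero d] (u v : List J) :
    Φ.ratio u / Φ.K * Φ.ratio v ≤ Φ.ratio (u ++ v) := by
  rw [ratio_append]
  exact mul_le_mul_of_nonneg_right
    (Φ.ratio_div_le_norm_fderiv u (Φ.mapsTo_V_word v Φ.base_mem_V)) (Φ.ratio_pos v).le

theorem disjoint_image_interior_word {u v : List J} (huv : ¬ u <+: v) (hvu : ¬ v <+: u) :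
    Disjoint (compMaps Φ.T u '' interior Φ.X) (compMaps Φ.T v '' interior Φ.X) := by
  induction u generalizing v with
  | nil => exact absurd List.nil_prefix huv
  | cons i u ih =>
    cases v with
    | nil => exact absurd List.nil_prefix hvu
    | cons j v =>
      simp only [compMaps, image_comp]
      by_cases hij : i = j
      · subst hij
        simp only [List.cons_prefix_cons, true_and] at huv hvu
        have hsub : ∀ w : List J, compMaps Φ.T w '' interior Φ.X ⊆ Φ.V := fun w =>
          ((Φ.mapsTo_interior_word w).mono_right Φ.interior_subset_V).image_subset
        refine disjoint_left.2 ?_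
        rintro _ ⟨x, hx, rfl⟩ ⟨y, hy, hyx⟩
        have := Φ.injOn_V i (hsub v hy) (hsub u hx) hyx
        exact disjoint_left.1 (ih huv hvu) hx (this ▸ hy)
      · exact (Φ.disjoint_image_interior i j hij).mono
          (image_mono (Φ.mapsTo_interior_word u).image_subset)
          (image_mono (Φ.mapsTo_interior_word v).image_subset)

theorem measurableSet_image_interior_word (u : List J) :
    MeasurableSet (compMaps Φ.T u '' interior Φ.X) :=
  measurable_image_of_fderivWithin isOpen_interior.measurableSet
    (fun _ hx => ((Φ.differentiableAt_word u
      (Φ.interior_subset_V hx)).hasFDerivAt.hasFDerivWithinAt))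
    ((Φ.injOn_V_word u).mono Φ.interior_subset_V)

theorem le_volume_image_interior_word [NeZero d] (u : List J) :
    ENNReal.ofReal ((Φ.ratio u / Φ.K) ^ d) * volume (interior Φ.X) ≤
      volume (compMaps Φ.T u '' interior Φ.X) := by
  rw [← lintegral_abs_det_fderiv_eq_addHaar_image volume isOpen_interior.measurableSet
    (fun x hx => ((Φ.differentiableAt_word u
      (Φ.interior_subset_V hx)).hasFDerivAt.hasFDerivWithinAt))
    ((Φ.injOn_V_word u).mono Φ.interior_subset_V), ← setLIntegral_const]
  refine setLIntegral_mono' isOpen_interior.measurableSet fun x hx => ?_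
  rw [(Φ.conformal_word u (Φ.interior_subset_V hx)).abs_det_eq]
  exact ENNReal.ofReal_le_ofReal (pow_le_pow_left₀ (div_nonneg (norm_nonneg _) Φ.K_pos.le)
    (Φ.ratio_div_le_norm_fderiv u (Φ.interior_subset_V hx)) d)

theorem exists_dist_word_le_of_dist_lt : ∃ δ, 0 < δ ∧ ∀ u : List J, ∀ x ∈ Φ.X, ∀ y,
    dist y x < δ → dist (compMaps Φ.T u y) (compMaps Φ.T u x) ≤ Φ.K * Φ.ratio u * dist y x := by
  obtain ⟨δ, hδ, h⟩ := Φ.isCompact_X.exists_thickening_subset_open Φ.isOpen_V Φ.X_subset_V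
  refine ⟨δ, hδ, fun u x hx y hy => ?_⟩
  have hb : ball x δ ⊆ Φ.V := (ball_subset_thickening hx δ).trans h
  rw [dist_eq_norm, dist_eq_norm]
  exact (convex_ball x δ).norm_image_sub_le_of_norm_fderiv_le
    (fun z hz => Φ.differentiableAt_word u (hb hz)) (fun z hz => Φ.norm_fderiv_le u (hb hz))
    (mem_ball_self hδ) hy

theorem _root_.IsPreconnected.dist_le_of_subset_biUnion_closedBall {α ι : Type*}
    [PseudoMetricSpace α] {A : Set α} (hA : IsPreconnected A) {t : Finset ι} {z : ι → α} {R : ℝ}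
    (hR : 0 ≤ R) (h : A ⊆ ⋃ i ∈ t, closedBall (z i) R) {x y : α} (hx : x ∈ A) (hy : y ∈ A) :
    dist x y ≤ t.card * (2 * R) := by
  have hI : Icc 0 (dist x y) ⊆ ⋃ i ∈ t, closedBall (dist x (z i)) R := by
    have h1 : Icc (dist x x) (dist x y) ⊆ (fun w => dist x w) '' A :=
      (hA.image _ (by fun_prop)).Icc_subset ⟨x, hx, rfl⟩ ⟨y, hy, rfl⟩
    rw [dist_self] at h1
    refine h1.trans ?_
    rintro _ ⟨w, hw, rfl⟩
    obtain ⟨i, hi, hwi⟩ := mem_iUnion₂.1 (h hw)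
    refine mem_iUnion₂.2 ⟨i, hi, ?_⟩
    rw [mem_closedBall, Real.dist_eq]
    rw [mem_closedBall] at hwi
    change |dist x w - dist x (z i)| ≤ R
    rw [dist_comm x w, dist_comm x (z i)]
    exact (abs_dist_sub_le w (z i) x).trans hwi
  have := (measure_mono hI).trans (measure_biUnion_finset_le (μ := volume) t _)
  simp only [Real.volume_Icc, sub_zero, Real.volume_closedBall, Finset.sum_const,
    nsmul_eq_mul] at this
  rw [← ENNReal.ofReal_natCast, ← ENNReal.ofReal_mul (by positivity)] at this
  exact (ENNReal.ofReal_le_ofReal_iff (by positivity)).1 this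

theorem exists_dist_word_le : ∃ D, 1 ≤ D ∧ ∀ u : List J, ∀ x ∈ Φ.X, ∀ y ∈ Φ.X,
    dist (compMaps Φ.T u x) (compMaps Φ.T u y) ≤ D * Φ.ratio u * dist x y := by
  obtain ⟨δ, hδ, h⟩ := Φ.exists_dist_word_le_of_dist_lt
  obtain ⟨t, htX, htf, ht⟩ := finite_cover_balls_of_compact Φ.isCompact_X hδ
  lift t to Finset (EuclideanSpace ℝ (Fin d)) using htf
  have hK := Φ.K_pos
  refine ⟨Φ.K + t.card * (2 * Φ.K), le_add_of_le_of_nonneg Φ.one_le_K (by positivity),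
    fun u x hx y hy => ?_⟩
  have hr : 0 ≤ Φ.ratio u := norm_nonneg _
  rcases lt_or_ge (dist x y) δ with hxy | hxy
  · refine (h u y hy x hxy).trans ?_
    gcongr
    exact le_add_of_nonneg_right (by positivity)
  · have hcov : compMaps Φ.T u '' Φ.X ⊆
        ⋃ z ∈ t, closedBall (compMaps Φ.T u z) (Φ.K * Φ.ratio u * δ) := by
      rintro _ ⟨w, hw, rfl⟩
      obtain ⟨z, hz, hwz⟩ := mem_iUnion₂.1 (ht hw)
      refine mem_iUnion₂.2 ⟨z, hz, mem_closedBall.2 ((h u z (htX hz) w hwz).trans ?_)⟩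
      have := (mem_ball.1 hwz).le
      gcongr
    have hconn : IsPreconnected (compMaps Φ.T u '' Φ.X) := Φ.isPreconnected_X.image _
      ((Φ.differentiableOn_V_word u).continuousOn.mono Φ.X_subset_V)
    have := hconn.dist_le_of_subset_biUnion_closedBall (by positivity) hcov
      ⟨x, hx, rfl⟩ ⟨y, hy, rfl⟩
    calc dist (compMaps Φ.T u x) (compMaps Φ.T u y)
        ≤ t.card * (2 * (Φ.K * Φ.ratio u * δ)) := this
      _ = (t.card * (2 * Φ.K)) * Φ.ratio u * δ := by ring
      _ ≤ (Φ.K + t.card * (2 * Φ.K)) * Φ.ratio u * dist x y := by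
        gcongr
        exact le_add_of_nonneg_left hK.le

/-- The limit set of a conformal system. -/
def limit : Set (EuclideanSpace ℝ (Fin d)) := limitSetOf Φ.T Φ.X

theorem mem_limit {x : EuclideanSpace ℝ (Fin d)} : x ∈ Φ.limit ↔
    ∃ γ : ℕ → J, ∀ n : ℕ, x ∈ compMaps Φ.T (List.ofFn fun k : Fin n => γ k) '' Φ.X :=
  mem_limitSetOf Φ.mapsTo_X

theorem limit_subset_X : Φ.limit ⊆ Φ.X := limitSetOf_subset Φ.mapsTo_X

theorem totallyBounded_X : TotallyBounded Φ.X := Φ.isCompact_X.totallyBounded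

theorem exists_fixedPoint (j : J) : ∃ x ∈ Φ.X, Φ.T j x = x := by
  have hc : ContractingWith ⟨Φ.c, Φ.c_pos.le⟩ ((Φ.mapsTo_X j).restrict (Φ.T j) Φ.X Φ.X) :=
    ⟨Φ.c_lt_one, LipschitzWith.of_dist_le_mul fun x y => Φ.dist_le j x x.2 y y.2⟩
  obtain ⟨y, hy, hfix, -⟩ := hc.exists_fixedPoint' Φ.isCompact_X.isComplete (Φ.mapsTo_X j)
    Φ.base_mem_X (edist_ne_top _ _)
  exact ⟨y, hy, hfix⟩

theorem mem_limit_of_fixed {j : J} {x : EuclideanSpace ℝ (Fin d)} (hx : x ∈ Φ.X)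
    (h : Φ.T j x = x) : x ∈ Φ.limit := by
  refine subset_limitSetOf Φ.mapsTo_X (A := {x}) (singleton_subset_iff.2 hx) ?_ rfl
  rintro _ rfl
  exact mem_iUnion.2 ⟨j, _, rfl, h⟩

/-- The system formed by the maps of a family of nonempty words, none of which is a prefix of
another. -/
def words {I : Type*} (f : I → List J) (hf : ∀ i, f i ≠ [])
    (hpre : ∀ i j, f i <+: f j → i = j) : ConformalSystem d I where
  X := Φ.X
  V := Φ.V
  T i := compMaps Φ.T (f i)
  c := Φ.c
  K := Φ.K
  isCompact_X := Φ.isCompact_X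
  isPreconnected_X := Φ.isPreconnected_X
  nonempty_interior := Φ.nonempty_interior
  isOpen_V := Φ.isOpen_V
  X_subset_V := Φ.X_subset_V
  mapsTo_X i := Φ.mapsTo_X_word _
  c_pos := Φ.c_pos
  c_lt_one := Φ.c_lt_one
  dist_le i x hx y hy := (Φ.dist_word_le _ hx hy).trans <| by
    gcongr
    exact pow_le_of_le_one Φ.c_pos.le Φ.c_lt_one.le (by simpa using hf i)
  mapsTo_V i := Φ.mapsTo_V_word _
  injOn_V i := Φ.injOn_V_word _
  differentiableOn_V i := Φ.differentiableOn_V_word _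
  conformal i x hx := Φ.conformal_word _ hx
  one_le_K := Φ.one_le_K
  distortion w x hx y hy := by
    rw [compMaps_map f (compMaps Φ.T) w, compMaps_flatten]
    exact Φ.distortion _ x hx y hy
  image_interior_subset i := (Φ.mapsTo_interior_word _).image_subset
  disjoint_image_interior i j hij := Φ.disjoint_image_interior_word
    (fun h => hij (hpre i j h)) (fun h => hij (hpre j i h).symm)

theorem limit_words_subset {I : Type*} (f : I → List J) (hf : ∀ i, f i ≠ [])
    (hpre : ∀ i j, f i <+: f j → i = j) : (Φ.words f hf hpre).limit ⊆ Φ.limit :=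
  limitSetOf_words_subset Φ.mapsTo_X (fun i => (Φ.injOn_V i).mono Φ.X_subset_V) f hf

end ConformalSystem

/-- The word formed by the first `n` letters of a sequence. -/
def prefixWord {J : Type*} (γ : ℕ → J) (n : ℕ) : List J := List.ofFn fun k : Fin n => γ k

section prefixWord

variable {J : Type*} (γ : ℕ → J)

theorem prefixWord_zero : prefixWord γ 0 = [] := by simp [prefixWord]

theorem prefixWord_succ (n : ℕ) : prefixWord γ (n + 1) = prefixWord γ n ++ [γ n] := by
  rw [prefixWord, List.ofFn_succ', List.concat_eq_append]
  rfl

theorem length_prefixWord (n : ℕ) : (prefixWord γ n).length = n := by simp [prefixWord]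

theorem prefixWord_eq_iff {γ γ' : ℕ → J} {n : ℕ} :
    prefixWord γ n = prefixWord γ' n ↔ ∀ k < n, γ k = γ' k := by
  rw [prefixWord, prefixWord, List.ofFn_inj, funext_iff]
  exact ⟨fun h k hk => h ⟨k, hk⟩, fun h k => h k k.2⟩

theorem take_prefixWord {m n : ℕ} (h : m ≤ n) : (prefixWord γ n).take m = prefixWord γ m := by
  induction n, h using Nat.le_induction with
  | base => exact List.take_of_length_le (length_prefixWord γ m).le
  | succ n hmn ih =>
    rw [prefixWord_succ, List.take_append_of_le_length (by rwa [length_prefixWord]), ih]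

theorem le_and_eq_of_prefixWord_prefix {γ γ' : ℕ → J} {m n : ℕ}
    (h : prefixWord γ m <+: prefixWord γ' n) : m ≤ n ∧ prefixWord γ m = prefixWord γ' m := by
  have hmn : m ≤ n := by simpa [length_prefixWord] using h.length_le
  refine ⟨hmn, ?_⟩
  rw [List.prefix_iff_eq_take, length_prefixWord, take_prefixWord γ' hmn] at h
  exact h

end prefixWord

namespace ConformalSystem

variable {d : ℕ} {J : Type*} (Φ : ConformalSystem d J)

theorem continuousOn_word (u : List J) : ContinuousOn (compMaps Φ.T u) Φ.X :=
  (Φ.differentiableOn_V_word u).continuousOn.mono Φ.X_subset_V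

theorem exists_mem_forall_image (γ : ℕ → J) :
    ∃ x, ∀ n, x ∈ compMaps Φ.T (prefixWord γ n) '' Φ.X := by
  have hc : ∀ n, IsCompact (compMaps Φ.T (prefixWord γ n) '' Φ.X) := fun n =>
    Φ.isCompact_X.image_of_continuousOn (Φ.continuousOn_word _)
  have := IsCompact.nonempty_iInter_of_sequence_nonempty_isCompact_isClosed
    (fun n => compMaps Φ.T (prefixWord γ n) '' Φ.X) (fun n => ?_)
    (fun n => ⟨_, Φ.base, Φ.base_mem_X, rfl⟩) (hc 0) (fun n => (hc n).isClosed)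
  · exact this.imp fun x hx => mem_iInter.1 hx
  · rw [prefixWord_succ, compMaps_append, image_comp]
    exact image_mono (Φ.mapsTo_X_word _).image_subset

/-- The coding map. -/
def code (γ : ℕ → J) : EuclideanSpace ℝ (Fin d) := (Φ.exists_mem_forall_image γ).choose

theorem code_mem_image (γ : ℕ → J) (n : ℕ) :
    Φ.code γ ∈ compMaps Φ.T (prefixWord γ n) '' Φ.X :=
  (Φ.exists_mem_forall_image γ).choose_spec n

theorem code_mem_limit (γ : ℕ → J) : Φ.code γ ∈ Φ.limit :=
  Φ.mem_limit.2 ⟨γ, Φ.code_mem_image γ⟩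

theorem tendsto_pow_c : Tendsto (fun n : ℕ => Φ.c ^ n) atTop (𝓝 0) :=
  tendsto_pow_atTop_nhds_zero_of_lt_one Φ.c_pos.le Φ.c_lt_one

theorem tendsto_code (γ : ℕ → J) :
    Tendsto (fun n => compMaps Φ.T (prefixWord γ n) Φ.base) atTop (𝓝 (Φ.code γ)) := by
  rw [tendsto_iff_dist_tendsto_zero]
  have h : Tendsto (fun n : ℕ => Φ.c ^ n * diam Φ.X) atTop (𝓝 0) := by
    simpa using Φ.tendsto_pow_c.mul_const (diam Φ.X)
  refine squeeze_zero (fun _ => dist_nonneg) (fun n => ?_) h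
  obtain ⟨x, hx, hxγ⟩ := Φ.code_mem_image γ n
  rw [← hxγ]
  refine (Φ.dist_word_le _ Φ.base_mem_X hx).trans ?_
  rw [length_prefixWord]
  exact mul_le_mul_of_nonneg_left
    (dist_le_diam_of_mem Φ.isCompact_X.isBounded Φ.base_mem_X hx) (pow_nonneg Φ.c_pos.le _)

theorem measurable_code [Countable J] [MeasurableSpace J] [MeasurableSingletonClass J] :
    Measurable Φ.code := by
  refine measurable_of_tendsto_metrizable (f := fun n γ => compMaps Φ.T (prefixWord γ n) Φ.base)
    (fun n => ?_) (tendsto_pi_nhds.2 Φ.tendsto_code)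
  have h : Measurable fun γ : ℕ → J => fun k : Fin n => γ k :=
    measurable_pi_lambda _ fun k => measurable_pi_apply (k : ℕ)
  exact (Measurable.of_discrete (f := fun v : Fin n → J =>
    compMaps Φ.T (List.ofFn v) Φ.base)).comp h

theorem exists_ratio_le {r : ℝ} (hr : 0 < r) (γ : ℕ → J) : ∃ n, Φ.ratio (prefixWord γ n) ≤ r := by
  obtain ⟨n, hn⟩ := (Φ.tendsto_pow_c.eventually (gt_mem_nhds hr)).exists
  refine ⟨n, (Φ.ratio_le_pow _).trans ?_⟩
  rw [length_prefixWord]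
  exact hn.le

open Classical in
/-- The length of the shortest prefix of a sequence whose ratio is at most `r`. -/
def stopLength {r : ℝ} (hr : 0 < r) (γ : ℕ → J) : ℕ := Nat.find (Φ.exists_ratio_le hr γ)

/-- The shortest prefix of a sequence whose ratio is at most `r`. -/
def stopWord {r : ℝ} (hr : 0 < r) (γ : ℕ → J) : List J := prefixWord γ (Φ.stopLength hr γ)

theorem ratio_stopWord_le {r : ℝ} (hr : 0 < r) (γ : ℕ → J) : Φ.ratio (Φ.stopWord hr γ) ≤ r := by
  classical exact Nat.find_spec (Φ.exists_ratio_le hr γ)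

theorem stopLength_le {r : ℝ} (hr : 0 < r) {γ : ℕ → J} {n : ℕ}
    (h : Φ.ratio (prefixWord γ n) ≤ r) : Φ.stopLength hr γ ≤ n := by
  classical exact Nat.find_min' _ h

theorem exists_stopLength_eq_succ [NeZero d] {r : ℝ} (hr : 0 < r) (hr1 : r < 1) (γ : ℕ → J) :
    ∃ n, Φ.stopLength hr γ = n + 1 ∧ r < Φ.ratio (prefixWord γ n) := by
  cases h : Φ.stopLength hr γ with
  | zero =>
    have := Φ.ratio_stopWord_le hr γ
    rw [stopWord, h, prefixWord_zero, ratio_nil] at this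
    exact absurd this hr1.not_ge
  | succ n =>
    refine ⟨n, rfl, lt_of_not_ge fun hn => ?_⟩
    have := Φ.stopLength_le hr hn
    omega

theorem stopWord_eq_of_prefix {r : ℝ} (hr : 0 < r) {γ γ' : ℕ → J}
    (h : Φ.stopWord hr γ <+: Φ.stopWord hr γ') : Φ.stopWord hr γ = Φ.stopWord hr γ' := by
  obtain ⟨h1, h2⟩ := le_and_eq_of_prefixWord_prefix h
  have h3 : Φ.stopLength hr γ' ≤ Φ.stopLength hr γ := by
    refine Φ.stopLength_le hr ?_
    rw [← h2]
    exact Φ.ratio_stopWord_le hr γ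
  rw [stopWord, h2, stopWord, le_antisymm h1 h3]

theorem exists_stopWord_encard_le [NeZero d] [Finite J] : ∃ M : ENNReal, M ≠ ⊤ ∧
    ∀ (r : ℝ) (hr : 0 < r), r < 1 → ∀ x : EuclideanSpace ℝ (Fin d),
      ∑' _ : Φ.stopWord hr '' (Φ.code ⁻¹' closedBall x r), (1 : ENNReal) ≤ M := by
  cases nonempty_fintype J
  rcases isEmpty_or_nonempty J with hJ | hJ
  · refine ⟨0, ENNReal.zero_ne_top, fun r hr _ x => ?_⟩
    have : IsEmpty (ℕ → J) := ⟨fun γ => hJ.elim (γ 0)⟩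
    rw [eq_empty_of_isEmpty (Φ.code ⁻¹' closedBall x r)]
    simp
  obtain ⟨j₀, -, hj₀⟩ := Finset.exists_min_image Finset.univ (fun j => Φ.ratio [j])
    Finset.univ_nonempty
  set m := Φ.ratio [j₀] with hm
  have hm0 : 0 < m := Φ.ratio_pos _
  have hK := Φ.K_pos
  obtain ⟨D, hD, hDist⟩ := Φ.exists_dist_word_le
  set b := m / Φ.K / Φ.K with hb
  have hb0 : 0 < b := by positivity
  set R := 1 + D * diam Φ.X with hR
  have hR0 : 0 ≤ R := by have := diam_nonneg (s := Φ.X); positivity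
  set a : ENNReal := ENNReal.ofReal (b ^ d) * volume (interior Φ.X) with ha
  have ha0 : a ≠ 0 := mul_ne_zero (by simpa using pow_pos hb0 d)
    (isOpen_interior.measure_pos volume Φ.nonempty_interior).ne'
  have hat : a ≠ ⊤ := ENNReal.mul_ne_top ENNReal.ofReal_ne_top
    ((measure_mono interior_subset).trans_lt Φ.isCompact_X.measure_lt_top).ne
  set e : ENNReal := ENNReal.ofReal (R ^ d) *
    volume (closedBall (0 : EuclideanSpace ℝ (Fin d)) 1) with he
  have het : e ≠ ⊤ := ENNReal.mul_ne_top ENNReal.ofReal_ne_top measure_closedBall_lt_top.ne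
  refine ⟨e / a, ENNReal.div_ne_top het ha0, fun r hr hr1 x => ?_⟩
  set W := Φ.stopWord hr '' (Φ.code ⁻¹' closedBall x r) with hW
  have hvol : ∀ w ∈ W, ENNReal.ofReal (r ^ d) * a ≤ volume (compMaps Φ.T w '' interior Φ.X) := by
    rintro _ ⟨γ, -, rfl⟩
    refine le_trans ?_ (Φ.le_volume_image_interior_word _)
    rw [ha, ← mul_assoc, ← ENNReal.ofReal_mul (by positivity), ← mul_pow]
    gcongr
    obtain ⟨n, hn, hrn⟩ := Φ.exists_stopLength_eq_succ hr hr1 γ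
    rw [stopWord, hn, prefixWord_succ, hb, mul_div_assoc', le_div_iff₀ hK, div_mul_cancel₀ _ hK.ne']
    refine le_trans ?_ (Φ.le_ratio_append _ _)
    rw [mul_div_assoc', div_mul_eq_mul_div]
    exact div_le_div_of_nonneg_right
      (mul_le_mul hrn.le (hj₀ _ (Finset.mem_univ _)) hm0.le (Φ.ratio_pos _).le) hK.le
  have hsub : ⋃ w ∈ W, compMaps Φ.T w '' interior Φ.X ⊆ closedBall x (R * r) := by
    refine iUnion₂_subset ?_
    rintro _ ⟨γ, hγ, rfl⟩ _ ⟨z, hz, rfl⟩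
    obtain ⟨y, hy, hyγ⟩ := Φ.code_mem_image γ (Φ.stopLength hr γ)
    rw [mem_closedBall]
    calc dist (compMaps Φ.T (Φ.stopWord hr γ) z) x
        ≤ dist (compMaps Φ.T (Φ.stopWord hr γ) z) (Φ.code γ) + dist (Φ.code γ) x :=
          dist_triangle _ _ _
      _ ≤ D * r * diam Φ.X + r := by
          refine add_le_add ?_ hγ
          rw [← hyγ]
          refine (hDist _ _ (interior_subset hz) _ hy).trans ?_
          have h1 := Φ.ratio_stopWord_le hr γ
          have h2 := dist_le_diam_of_mem Φ.isCompact_X.isBounded (interior_subset hz) hy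
          gcongr
      _ = R * r := by rw [hR]; ring
  have hdisj : W.PairwiseDisjoint fun w => compMaps Φ.T w '' interior Φ.X := by
    rintro _ ⟨γ, -, rfl⟩ _ ⟨γ', -, rfl⟩ hne
    exact Φ.disjoint_image_interior_word (fun h => hne (Φ.stopWord_eq_of_prefix hr h))
      fun h => hne (Φ.stopWord_eq_of_prefix hr h).symm
  have hr0 : ENNReal.ofReal (r ^ d) ≠ 0 := by simpa using pow_pos hr d
  rw [ENNReal.le_div_iff_mul_le (Or.inl ha0) (Or.inl hat),
    ← ENNReal.mul_le_mul_iff_right hr0 ENNReal.ofReal_ne_top, mul_left_comm,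
    ← ENNReal.tsum_mul_right]
  simp only [one_mul]
  calc ∑' _ : W, ENNReal.ofReal (r ^ d) * a
      ≤ ∑' w : W, volume (compMaps Φ.T w '' interior Φ.X) :=
        ENNReal.tsum_le_tsum fun w => hvol w w.2
    _ = volume (⋃ w ∈ W, compMaps Φ.T w '' interior Φ.X) :=
        (measure_biUnion W.to_countable hdisj
          fun w _ => Φ.measurableSet_image_interior_word w).symm
    _ ≤ volume (closedBall x (R * r)) := measure_mono hsub
    _ = ENNReal.ofReal (r ^ d) * e := by
        rw [Measure.addHaar_closedBall' _ _ (by positivity), he, ← mul_assoc,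
          ← ENNReal.ofReal_mul (by positivity), finrank_euclideanSpace_fin,
          mul_pow, mul_comm (R ^ d)]

theorem prod_le_ratio_rpow [NeZero d] {s : ℝ} (hs : 0 ≤ s) {p : J → ℝ} (hp0 : ∀ j, 0 ≤ p j)
    (hp : ∀ j, p j ≤ (Φ.ratio [j] / Φ.K) ^ s) (γ : ℕ → J) (n : ℕ) :
    ∏ k ∈ Finset.range n, p (γ k) ≤ Φ.ratio (prefixWord γ n) ^ s := by
  induction n with
  | zero => simp [prefixWord_zero, ratio_nil]
  | succ n ih =>
    have h1 := (Φ.ratio_pos (prefixWord γ n)).le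
    have h2 := (Φ.ratio_pos [γ n]).le
    have hK := Φ.K_pos
    rw [Finset.prod_range_succ, prefixWord_succ]
    calc _ ≤ Φ.ratio (prefixWord γ n) ^ s * (Φ.ratio [γ n] / Φ.K) ^ s := by
          gcongr
          · exact hp0 _
          · exact hp _
      _ = (Φ.ratio (prefixWord γ n) / Φ.K * Φ.ratio [γ n]) ^ s := by
          rw [← Real.mul_rpow h1 (by positivity)]
          congr 1
          ring
      _ ≤ _ := by
          gcongr
          exact Φ.le_ratio_append _ _

end ConformalSystem

namespace ConformalSystem

variable {d : ℕ} {J : Type*} (Φ : ConformalSystem d J)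

theorem exists_measure_le [NeZero d] [Fintype J] {s : ℝ} (hs : 0 < s)
    (h : 1 ≤ ∑ j, (Φ.ratio [j] / Φ.K) ^ s) :
    ∃ (μ : Measure (EuclideanSpace ℝ (Fin d))) (M : ENNReal), M ≠ ⊤ ∧ 1 ≤ μ Φ.limit ∧
      ∀ r, 0 < r → r < 1 → ∀ x, μ (closedBall x r) ≤ M * ENNReal.ofReal r ^ s := by
  have hK := Φ.K_pos
  set q : J → ℝ := fun j => (Φ.ratio [j] / Φ.K) ^ s with hq
  have hq0 : ∀ j, 0 ≤ q j := fun j =>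
    Real.rpow_nonneg (div_nonneg (Φ.ratio_pos _).le hK.le) _
  set Q := ∑ j, q j with hQ
  have hQ0 : 0 < Q := one_pos.trans_le h
  set p : J → ℝ := fun j => q j / Q with hp
  have hp0 : ∀ j, 0 ≤ p j := fun j => div_nonneg (hq0 j) hQ0.le
  have hpq : ∀ j, p j ≤ q j := fun j => div_le_self (hq0 j) h
  let _ : MeasurableSpace J := ⊤
  have hsum : ∑ j, ENNReal.ofReal (p j) = 1 := by
    rw [← ENNReal.ofReal_sum_of_nonneg fun j _ => hp0 j, ← Finset.sum_div, div_self hQ0.ne',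
      ENNReal.ofReal_one]
  set ν := (PMF.ofFintype (fun j => ENNReal.ofReal (p j)) hsum).toMeasure with hν
  have hν1 : ∀ j, ν {j} = ENNReal.ofReal (p j) := fun j => by
    rw [hν, PMF.toMeasure_apply_singleton _ _ (MeasurableSet.singleton j), PMF.ofFintype_apply]
  set P := Measure.infinitePi (fun _ : ℕ => ν) with hP
  have hcyl : ∀ (γ : ℕ → J) n,
      P {ω | prefixWord ω n = prefixWord γ n} ≤ ENNReal.ofReal (Φ.ratio (prefixWord γ n) ^ s) := by
    intro γ n
    have hset : {ω | prefixWord ω n = prefixWord γ n} =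
        Set.pi (Finset.range n : Set ℕ) fun k => {γ k} := by
      ext ω
      simp [prefixWord_eq_iff, Set.mem_pi]
    rw [hset, hP, Measure.infinitePi_pi _ fun _ _ => MeasurableSet.singleton _]
    simp only [hν1]
    rw [← ENNReal.ofReal_prod_of_nonneg fun k _ => hp0 _]
    exact ENNReal.ofReal_le_ofReal (Φ.prod_le_ratio_rpow hs.le hp0 hpq γ n)
  obtain ⟨M, hM, hMle⟩ := Φ.exists_stopWord_encard_le
  refine ⟨P.map Φ.code, M, hM, ?_, fun r hr hr1 x => ?_⟩
  · refine le_trans ?_ (Measure.le_map_apply Φ.measurable_code.aemeasurable _)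
    rw [eq_univ_of_forall (s := Φ.code ⁻¹' Φ.limit) Φ.code_mem_limit, measure_univ]
  · rw [Measure.map_apply Φ.measurable_code measurableSet_closedBall]
    set W := Φ.stopWord hr '' (Φ.code ⁻¹' closedBall x r) with hW
    have hsub : Φ.code ⁻¹' closedBall x r ⊆ ⋃ w ∈ W, {ω | prefixWord ω w.length = w} := by
      intro ω hω
      refine mem_iUnion₂.2 ⟨Φ.stopWord hr ω, ⟨ω, hω, rfl⟩, ?_⟩
      change prefixWord ω _ = _
      rw [stopWord, length_prefixWord]
    have hw : ∀ w ∈ W, P {ω | prefixWord ω w.length = w} ≤ ENNReal.ofReal r ^ s := by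
      rintro _ ⟨γ, -, rfl⟩
      rw [ENNReal.ofReal_rpow_of_pos hr]
      rw [stopWord, length_prefixWord]
      refine (hcyl γ _).trans (ENNReal.ofReal_le_ofReal ?_)
      exact Real.rpow_le_rpow (Φ.ratio_pos _).le (Φ.ratio_stopWord_le hr γ) hs.le
    calc P (Φ.code ⁻¹' closedBall x r)
        ≤ ∑' w : W, P {ω | prefixWord ω w.1.length = w.1} :=
          (measure_mono hsub).trans (measure_biUnion_le P W.to_countable _)
      _ ≤ ∑' _ : W, 1 * ENNReal.ofReal r ^ s := ENNReal.tsum_le_tsum fun w => by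
          rw [one_mul]
          exact hw w w.2
      _ ≤ M * ENNReal.ofReal r ^ s := by
          rw [ENNReal.tsum_mul_right]
          exact mul_le_mul_left (hMle r hr hr1 x) _

/-- The mass distribution principle, in terms of closed balls of radius less than one. -/
theorem _root_.MeasureTheory.Measure.le_dimH_of_closedBall_le {α : Type*} [MetricSpace α]
    [MeasurableSpace α] [BorelSpace α] (μ : Measure α) {s : NNReal} {M : ENNReal} (hM : M ≠ ⊤)
    {A : Set α} (hA : μ A ≠ 0)
    (h : ∀ r, 0 < r → r < 1 → ∀ x, μ (closedBall x r) ≤ M * ENNReal.ofReal r ^ (s : ℝ)) :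
    (s : ENNReal) ≤ dimH A := by
  have hle : (M + 1)⁻¹ • μ ≤ Measure.hausdorffMeasure s := by
    refine Measure.le_hausdorffMeasure _ _ (ENNReal.ofReal (1 / 2)) (by simp) fun B hB => ?_
    rcases B.eq_empty_or_nonempty with rfl | ⟨x, hx⟩
    · simp
    have hBt : ediam B ≠ ⊤ := ne_top_of_le_ne_top ENNReal.ofReal_ne_top hB
    have hB2 : diam B ≤ 1 / 2 := ENNReal.toReal_le_of_le_ofReal (by norm_num) hB
    have hdiam : ENNReal.ofReal (diam B) = ediam B := ENNReal.ofReal_toReal hBt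
    have hM0 : M + 1 ≠ 0 := by simp
    have hM1 : M + 1 ≠ ⊤ := by simpa using hM
    have hev : ∀ᶠ r in 𝓝[>] (diam B), μ B ≤ (M + 1) * ENNReal.ofReal r ^ (s : ℝ) := by
      filter_upwards [self_mem_nhdsWithin,
        nhdsWithin_le_nhds (gt_mem_nhds (show diam B < 1 by linarith))] with r hr hr1
      have hr0 : 0 < r := diam_nonneg.trans_lt hr
      refine (measure_mono fun y hy => ?_).trans ((h r hr0 hr1 x).trans (by gcongr; simp))
      exact (dist_le_diam_of_mem' hBt hy hx).trans hr.le
    have hlim : Tendsto (fun r => (M + 1) * ENNReal.ofReal r ^ (s : ℝ)) (𝓝[>] (diam B))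
        (𝓝 ((M + 1) * ediam B ^ (s : ℝ))) := by
      rw [← hdiam]
      refine ENNReal.Tendsto.const_mul ?_ (Or.inr hM1)
      exact (((ENNReal.continuous_rpow_const.comp ENNReal.continuous_ofReal).tendsto _).mono_left
        nhdsWithin_le_nhds)
    rw [Measure.smul_apply, smul_eq_mul, ENNReal.inv_mul_le_iff hM0 hM1]
    exact ge_of_tendsto hlim hev
  refine le_dimH_of_hausdorffMeasure_ne_zero fun h0 => hA ?_
  have := hle A
  rw [h0, Measure.smul_apply, smul_eq_mul, nonpos_iff_eq_zero, mul_eq_zero] at this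
  exact this.resolve_left (by simpa using hM)

theorem le_dimH_limit [NeZero d] [Fintype J] {s : NNReal} (hs : 0 < s)
    (h : 1 ≤ ∑ j, (Φ.ratio [j] / Φ.K) ^ (s : ℝ)) : (s : ENNReal) ≤ dimH Φ.limit := by
  obtain ⟨μ, M, hM, hμ, hball⟩ := Φ.exists_measure_le (NNReal.coe_pos.2 hs) h
  exact μ.le_dimH_of_closedBall_le hM (one_pos.trans_le hμ).ne' hball

end ConformalSystem

namespace ConformalSystem

variable {d : ℕ} {J : Type*} (Φ : ConformalSystem d J)

theorem sum_ratio_div_rpow_le_one [NeZero d] {s : NNReal} (hs : dimH Φ.limit < s) {n : ℕ}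
    {W : Finset (List J)} (hW : ∀ w ∈ W, w.length = n) :
    ∑ w ∈ W, (Φ.ratio w / Φ.K) ^ (s : ℝ) ≤ 1 := by
  have hs0 : 0 < s := ENNReal.coe_pos.1 (bot_le.trans_lt hs)
  rcases Nat.eq_zero_or_pos n with rfl | hn
  · have hsub : W ⊆ {[]} := fun w hw => by
      simpa using List.length_eq_zero_iff.1 (hW w hw)
    have hK := Φ.K_pos
    refine (Finset.sum_le_sum_of_subset_of_nonneg hsub fun w _ _ =>
      Real.rpow_nonneg (div_nonneg (Φ.ratio_pos w).le hK.le) _).trans ?_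
    rw [Finset.sum_singleton, ratio_nil]
    exact Real.rpow_le_one (by positivity) ((div_le_one hK).2 Φ.one_le_K) s.2
  · by_contra! hlt
    have hne : ∀ w : W, (w : List J) ≠ [] := fun w hw => by
      have := hW w w.2
      simp [hw] at this
      omega
    have hpre : ∀ v w : W, (v : List J) <+: w → v = w := fun v w h =>
      Subtype.ext (h.eq_of_length ((hW v v.2).trans (hW w w.2).symm))
    have := (Φ.words (fun w : W => (w : List J)) hne hpre).le_dimH_limit hs0 (by
      rw [← Finset.sum_coe_sort] at hlt
      exact hlt.le)
    exact (this.trans (dimH_mono (Φ.limit_words_subset _ hne hpre))).not_gt hs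

theorem exists_sum_ratio_rpow_le [NeZero d] {s : ℝ} (hs : dimH Φ.limit < ENNReal.ofReal s) :
    ∃ C, ∀ U : Finset (List J), ∑ u ∈ U, Φ.ratio u ^ s ≤ C := by
  obtain ⟨t, ht, hts⟩ := ENNReal.lt_iff_exists_nnreal_btwn.1 hs
  have hts' : (t : ℝ) < s := by
    rw [← ENNReal.ofReal_coe_nnreal] at hts
    exact (ENNReal.ofReal_lt_ofReal_iff'.1 hts).1
  have hK := Φ.K_pos
  set θ := Φ.c ^ (s - t) with hθ
  have hθ0 : 0 ≤ θ := Real.rpow_nonneg Φ.c_pos.le _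
  have hθ1 : θ < 1 := Real.rpow_lt_one Φ.c_pos.le Φ.c_lt_one (sub_pos.2 hts')
  have hterm : ∀ u, Φ.ratio u ^ s ≤
      Φ.K ^ (t : ℝ) * θ ^ u.length * (Φ.ratio u / Φ.K) ^ (t : ℝ) := by
    intro u
    have hu := Φ.ratio_pos u
    have h1 : Φ.ratio u ^ (s - t) ≤ θ ^ u.length := by
      rw [hθ, ← Real.rpow_mul_natCast Φ.c_pos.le, mul_comm, Real.rpow_natCast_mul Φ.c_pos.le]
      exact Real.rpow_le_rpow hu.le (Φ.ratio_le_pow u) (sub_pos.2 hts').le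
    calc Φ.ratio u ^ s = Φ.ratio u ^ (s - t) * Φ.ratio u ^ (t : ℝ) := by
          rw [← Real.rpow_add hu, sub_add_cancel]
      _ ≤ θ ^ u.length * Φ.ratio u ^ (t : ℝ) := by gcongr
      _ = _ := by
          rw [Real.div_rpow hu.le hK.le]
          have := (Real.rpow_pos_of_pos hK (t : ℝ)).ne'
          field_simp
  refine ⟨Φ.K ^ (t : ℝ) * (1 - θ)⁻¹, fun U => ?_⟩
  classical
  calc ∑ u ∈ U, Φ.ratio u ^ s
      ≤ ∑ u ∈ U, Φ.K ^ (t : ℝ) * θ ^ u.length * (Φ.ratio u / Φ.K) ^ (t : ℝ) :=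
        Finset.sum_le_sum fun u _ => hterm u
    _ = ∑ n ∈ U.image List.length, ∑ u ∈ U with u.length = n,
          Φ.K ^ (t : ℝ) * θ ^ u.length * (Φ.ratio u / Φ.K) ^ (t : ℝ) :=
        (Finset.sum_fiberwise_of_maps_to (fun u hu => Finset.mem_image_of_mem _ hu) _).symm
    _ ≤ ∑ n ∈ U.image List.length, Φ.K ^ (t : ℝ) * θ ^ n := by
        refine Finset.sum_le_sum fun n _ => ?_
        rw [← mul_one (Φ.K ^ (t : ℝ) * θ ^ n)]
        have h1 := Φ.sum_ratio_div_rpow_le_one ht (n := n)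
          (W := {u ∈ U | u.length = n}) fun w hw => (Finset.mem_filter.1 hw).2
        refine le_trans (le_of_eq ?_) (mul_le_mul_of_nonneg_left h1
          (by positivity : 0 ≤ Φ.K ^ (t : ℝ) * θ ^ n))
        rw [Finset.mul_sum]
        refine Finset.sum_congr rfl fun u hu => ?_
        rw [(Finset.mem_filter.1 hu).2]
    _ ≤ Φ.K ^ (t : ℝ) * (1 - θ)⁻¹ := by
        rw [← Finset.mul_sum, ← tsum_geometric_of_lt_one hθ0 hθ1]
        gcongr
        exact (summable_geometric_of_lt_one hθ0 hθ1).sum_le_tsum _ fun n _ => pow_nonneg hθ0 n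

end ConformalSystem

namespace ConformalSystem

variable {d : ℕ} {J : Type*} (Φ : ConformalSystem d J)

theorem finite_setOf_le_ratio [NeZero d] {s : ℝ} (hs : 0 ≤ s) {C : ℝ}
    (hC : ∀ U : Finset (List J), ∑ u ∈ U, Φ.ratio u ^ s ≤ C) {r : ℝ} (hr : 0 < r) :
    {u | r ≤ Φ.ratio u}.Finite := by
  by_contra hinf
  obtain ⟨n, hn⟩ := exists_nat_gt (C / r ^ s)
  obtain ⟨U, hU, hUn⟩ := Set.Infinite.exists_subset_card_eq hinf n
  rw [div_lt_iff₀ (Real.rpow_pos_of_pos hr s)] at hn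
  refine ((Finset.card_nsmul_le_sum U (fun u => Φ.ratio u ^ s) (r ^ s) fun u hu =>
    Real.rpow_le_rpow hr.le (hU hu) hs).trans (hC U)).not_gt ?_
  rwa [hUn, nsmul_eq_mul]

theorem exists_prefix_ratio_lt [NeZero d] {r : ℝ} (hr : 0 < r) (hr1 : r ≤ 1) (γ : ℕ → J) :
    ∃ n, r ≤ Φ.ratio (prefixWord γ n) ∧ Φ.ratio (prefixWord γ (n + 1)) < r := by
  by_contra! h
  have hle : ∀ n, r ≤ Φ.ratio (prefixWord γ n) := fun n => by
    induction n with
    | zero => rwa [prefixWord_zero, ratio_nil]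
    | succ n ih => exact h n ih
  obtain ⟨n, hn⟩ := Φ.exists_ratio_le (half_pos hr) γ
  linarith [hle n]

variable {F : Set (EuclideanSpace ℝ (Fin d))}

theorem exists_coveringNumber_limit_le [NeZero d] (hFX : F ⊆ Φ.X) (hne : F.Nonempty)
    (hF : ∀ j, ∃ x ∈ F, Φ.T j x = x) :
    ∃ A, 0 < A ∧ ∀ r, 0 < r → r ≤ 1 → ∀ U : Finset (List J), (∀ u, r ≤ Φ.ratio u → u ∈ U) →
      _root_.coveringNumber Φ.limit (A * r) ≤
        ∑ u ∈ U, _root_.coveringNumber F (r / Φ.ratio u) := by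
  classical
  obtain ⟨D, hD, hDist⟩ := Φ.exists_dist_word_le
  have hFt : TotallyBounded F := Φ.totallyBounded_X.subset hFX
  have hdiam : 0 ≤ diam Φ.X := diam_nonneg
  refine ⟨D * (diam Φ.X + 2), by positivity, fun r hr hr1 U hU => ?_⟩
  choose t ht htF using fun u : List J =>
    exists_card_eq_coveringNumber hFt (div_pos hr (Φ.ratio_pos u))
  have hg : ∀ (u : List J) (x : EuclideanSpace ℝ (Fin d)), ∃ y ∈ F,
      ∀ z ∈ F, z ∈ ball x (r / Φ.ratio u) → dist z y < 2 * (r / Φ.ratio u) := by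
    intro u x
    by_cases h : ∃ y ∈ F, y ∈ ball x (r / Φ.ratio u)
    · obtain ⟨y, hy, hyx⟩ := h
      refine ⟨y, hy, fun z _ hzx => ?_⟩
      rw [mem_ball] at hyx hzx
      linarith [dist_triangle_right z y x]
    · obtain ⟨y, hy⟩ := hne
      exact ⟨y, hy, fun z hz hzx => absurd ⟨z, hz, hzx⟩ h⟩
  choose g hgF hg using hg
  have hcov : Φ.limit ⊆ ⋃ z ∈ U.biUnion fun u => (t u).image fun x => compMaps Φ.T u (g u x),
      ball z (D * (diam Φ.X + 2) * r) := by
    intro z hz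
    obtain ⟨γ, hγ⟩ := Φ.mem_limit.1 hz
    obtain ⟨n, hn, hn1⟩ := Φ.exists_prefix_ratio_lt hr hr1 γ
    obtain ⟨y, hy, hyz⟩ := hγ (n + 1)
    obtain ⟨f, hf, hfix⟩ := hF (γ n)
    change compMaps Φ.T (prefixWord γ (n + 1)) y = z at hyz
    set u := prefixWord γ n with hu
    obtain ⟨x, hx, hfx⟩ := mem_iUnion₂.1 (htF u hf)
    refine mem_iUnion₂.2 ⟨compMaps Φ.T u (g u x), Finset.mem_biUnion.2
      ⟨u, hU u hn, Finset.mem_image_of_mem _ hx⟩, ?_⟩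
    have hu0 := Φ.ratio_pos u
    have h1 : compMaps Φ.T (prefixWord γ (n + 1)) f = compMaps Φ.T u f := by
      rw [prefixWord_succ, compMaps_append, Function.comp_apply, compMaps_singleton, hfix]
    rw [mem_ball]
    calc dist z (compMaps Φ.T u (g u x))
        ≤ dist z (compMaps Φ.T u f) + dist (compMaps Φ.T u f) (compMaps Φ.T u (g u x)) :=
          dist_triangle _ _ _
      _ < D * r * diam Φ.X + D * Φ.ratio u * (2 * (r / Φ.ratio u)) := by
          refine add_lt_add_of_le_of_lt ?_ ?_
          · rw [← hyz, ← h1]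
            refine (hDist _ y hy f (hFX hf)).trans ?_
            have := dist_le_diam_of_mem Φ.isCompact_X.isBounded hy (hFX hf)
            gcongr
          · refine (hDist _ f (hFX hf) _ (hFX (hgF u x))).trans_lt ?_
            have := hg u x f hf hfx
            gcongr
      _ = D * (diam Φ.X + 2) * r := by field_simp
  refine (coveringNumber_le_card hcov).trans (Finset.card_biUnion_le.trans ?_)
  exact Finset.sum_le_sum fun u _ => Finset.card_image_le.trans (ht u).le

theorem exists_logCov_limit_le [NeZero d] (hFX : F ⊆ Φ.X) (hne : F.Nonempty)
    (hF : ∀ j, ∃ x ∈ F, Φ.T j x = x) (hlim : Φ.limit.Nonempty) :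
    ∃ a, ∀ s : ℝ, dimH Φ.limit < ENNReal.ofReal s → ∃ C, ∀ x, 0 ≤ x → ∀ B,
      (∀ y ∈ Icc 0 x, s * (x - y) + logCov F y ≤ B) → logCov Φ.limit (x - a) ≤ C + B := by
  obtain ⟨A, hA, hcov⟩ := Φ.exists_coveringNumber_limit_le hFX hne hF
  have hFt : TotallyBounded F := Φ.totallyBounded_X.subset hFX
  have hLt : TotallyBounded Φ.limit := Φ.totallyBounded_X.subset Φ.limit_subset_X
  refine ⟨Real.log A, fun s hs => ?_⟩
  have hs0 : 0 < s := ENNReal.ofReal_pos.1 (bot_le.trans_lt hs)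
  obtain ⟨C, hC⟩ := Φ.exists_sum_ratio_rpow_le hs
  refine ⟨Real.log C, fun x hx B hB => ?_⟩
  have hr := Real.exp_pos (-x)
  have hfin := Φ.finite_setOf_le_ratio hs0.le hC hr
  have hterm : ∀ u ∈ hfin.toFinset, (_root_.coveringNumber F (Real.exp (-x) / Φ.ratio u) : ℝ) ≤
      Φ.ratio u ^ s * Real.exp B := by
    intro u hu
    have hu : Real.exp (-x) ≤ Φ.ratio u := by simpa using hu
    have hu0 := Φ.ratio_pos u
    have hu1 : Φ.ratio u ≤ 1 :=
      (Φ.ratio_le_pow u).trans (pow_le_one₀ Φ.c_pos.le Φ.c_lt_one.le)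
    have h1 : Real.exp (-x) / Φ.ratio u = Real.exp (-(x + Real.log (Φ.ratio u))) := by
      rw [neg_add, Real.exp_add, Real.exp_neg (Real.log _), Real.exp_log hu0, div_eq_mul_inv]
    have h2 := hB (x + Real.log (Φ.ratio u))
      ⟨by linarith [(Real.le_log_iff_exp_le hu0).2 hu], by linarith [Real.log_nonpos hu0.le hu1]⟩
    have h3 := one_le_coveringNumber hFt hne (Real.exp_pos (-(x + Real.log (Φ.ratio u))))
    rw [h1, Real.rpow_def_of_pos hu0, ← Real.exp_add,
      ← Real.log_le_iff_le_exp (by exact_mod_cast h3)]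
    change logCov F _ ≤ _
    linarith
  have hexp : Real.exp (-(x - Real.log A)) = A * Real.exp (-x) := by
    rw [neg_sub, sub_eq_add_neg, Real.exp_add, Real.exp_log hA]
  have hN := one_le_coveringNumber hLt hlim (mul_pos hA hr)
  have hN1 : (1 : ℝ) ≤ _root_.coveringNumber Φ.limit (A * Real.exp (-x)) := by exact_mod_cast hN
  have hle : (_root_.coveringNumber Φ.limit (A * Real.exp (-x)) : ℝ) ≤ C * Real.exp B := by
    calc (_root_.coveringNumber Φ.limit (A * Real.exp (-x)) : ℝ)
        ≤ ∑ u ∈ hfin.toFinset, (_root_.coveringNumber F (Real.exp (-x) / Φ.ratio u) : ℝ) := by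
          exact_mod_cast hcov _ hr (Real.exp_le_one_iff.2 (by linarith)) _ fun u hu => by
            simpa using hu
      _ ≤ ∑ u ∈ hfin.toFinset, Φ.ratio u ^ s * Real.exp B := Finset.sum_le_sum hterm
      _ ≤ C * Real.exp B := by
          rw [← Finset.sum_mul]
          exact mul_le_mul_of_nonneg_right (hC _) (Real.exp_pos B).le
  have hC0 : 0 < C := pos_of_mul_pos_left (one_pos.trans_le (hN1.trans hle)) (Real.exp_pos B).le
  rw [logCov, hexp]
  refine (Real.log_le_log (one_pos.trans_le hN1) hle).trans_eq ?_
  rw [Real.log_mul hC0.ne' (Real.exp_pos B).ne', Real.log_exp]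

end ConformalSystem

/-- The conformal system formed by the extended maps of a `CIFS`. -/
def CIFS.toConformalSystem {d : ℕ} (Φ : CIFS d) : ConformalSystem d Φ.I where
  X := Φ.X
  V := Φ.V
  T := Φ.T
  c := Φ.c
  K := Φ.K
  isCompact_X := Φ.hXcompact
  isPreconnected_X := Φ.hXconn.isPreconnected
  nonempty_interior := Φ.hXint
  isOpen_V := Φ.hVopen
  X_subset_V := Φ.hXV
  mapsTo_X i x hx := by
    rw [Φ.hTagree i x hx]
    exact Φ.hSmaps i hx
  c_pos := Φ.hc0
  c_lt_one := Φ.hc1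
  dist_le i x hx y hy := by
    rw [Φ.hTagree i x hx, Φ.hTagree i y hy]
    exact (Φ.hcontr i x hx y hy).2
  mapsTo_V := Φ.hTmaps
  injOn_V := Φ.hTinj
  differentiableOn_V i := (Φ.hTdiff i).differentiableOn one_ne_zero
  conformal := Φ.hTconf
  one_le_K := Φ.hK
  distortion := Φ.hBD
  image_interior_subset i := by
    rw [image_congr fun x hx => Φ.hTagree i x (interior_subset hx)]
    exact Φ.hOSCin i
  disjoint_image_interior i j hij := by
    rw [image_congr fun x hx => Φ.hTagree i x (interior_subset hx),
      image_congr fun x hx => Φ.hTagree j x (interior_subset hx)]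
    exact Φ.hOSCdisj i j hij

theorem CIFS.limitSet_eq {d : ℕ} (Φ : CIFS d) : Φ.limitSet = Φ.toConformalSystem.limit := by
  refine iUnion_congr fun γ => iInter_congr fun n => image_congr ?_
  exact fun x hx => compMaps_eqOn Φ.toConformalSystem.mapsTo_X
    (fun i y hy => (Φ.hTagree i y hy).symm) _ hx

theorem CIFS.exists_mem_fixedPoints {d : ℕ} (Φ : CIFS d) (i : Φ.I) :
    ∃ x ∈ Φ.fixedPoints, Φ.T i x = x := by
  obtain ⟨x, hx, hfix⟩ := Φ.toConformalSystem.exists_fixedPoint i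
  exact ⟨x, ⟨hx, i, (Φ.hTagree i x hx).symm.trans hfix⟩, hfix⟩

theorem CIFS.fixedPoints_subset_limitSet {d : ℕ} (Φ : CIFS d) : Φ.fixedPoints ⊆ Φ.limitSet := by
  rintro x ⟨hx, i, hi⟩
  rw [limitSet_eq]
  exact Φ.toConformalSystem.mem_limit_of_fixed hx ((Φ.hTagree i x hx).trans hi)

theorem CIFS.nonempty_fixedPoints {d : ℕ} (Φ : CIFS d) : Φ.fixedPoints.Nonempty := by
  obtain ⟨i⟩ := Φ.hInonempty
  obtain ⟨x, hx, -⟩ := Φ.exists_mem_fixedPoints i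
  exact ⟨x, hx⟩

theorem CIFS.totallyBounded_limitSet {d : ℕ} (Φ : CIFS d) : TotallyBounded Φ.limitSet := by
  rw [limitSet_eq]
  exact Φ.toConformalSystem.totallyBounded_X.subset Φ.toConformalSystem.limit_subset_X

theorem CIFS.exists_logCov_limitSet_le {d : ℕ} [NeZero d] (Φ : CIFS d) :
    ∃ a, ∀ s > (dimH Φ.limitSet).toReal, ∃ C, ∀ x ≥ 0, ∀ B,
      (∀ y ∈ Icc 0 x, s * (x - y) + logCov Φ.fixedPoints y ≤ B) →
        logCov Φ.limitSet (x - a) ≤ C + B := by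
  have hne := Φ.nonempty_fixedPoints.mono Φ.fixedPoints_subset_limitSet
  rw [limitSet_eq] at hne ⊢
  obtain ⟨a, ha⟩ := Φ.toConformalSystem.exists_logCov_limit_le (F := Φ.fixedPoints)
    (fun x hx => hx.1) Φ.nonempty_fixedPoints Φ.exists_mem_fixedPoints hne
  refine ⟨a, fun s hs => ha s ?_⟩
  exact (ENNReal.lt_ofReal_iff_toReal_lt (Real.dimH_ne_top _)).2 hs

theorem CIFS.dimLB_limitSet_le_of_le {d : ℕ} [NeZero d] (Φ : CIFS d)
    (h : dimUB Φ.fixedPoints ≤ (dimH Φ.limitSet).toReal) :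
    dimLB Φ.limitSet ≤ (dimH Φ.limitSet).toReal := by
  have hF := Φ.totallyBounded_limitSet.subset Φ.fixedPoints_subset_limitSet
  obtain ⟨a, hL⟩ := Φ.exists_logCov_limitSet_le
  exact le_of_forall_pos_le_add fun ε hε => dimLB_le_of_frequently
    (frequently_le_of_le_rate (logCov_mono hF Φ.nonempty_fixedPoints)
      (logCov_nonneg _) ENNReal.toReal_nonneg
      (fun t' ht' => eventually_logCov_le_of_dimUB_lt hF Φ.nonempty_fixedPoints ht') hL h hε)

theorem CIFS.dimLB_limitSet_le_of_lt {d : ℕ} [NeZero d] (Φ : CIFS d)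
    (h : (dimH Φ.limitSet).toReal < dimUB Φ.fixedPoints) :
    dimLB Φ.limitSet ≤ (dimH Φ.limitSet).toReal +
      (dimUB Φ.fixedPoints - (dimH Φ.limitSet).toReal) *
        ((d : ℝ) - (dimH Φ.limitSet).toReal) * dimLB Φ.fixedPoints /
        ((d : ℝ) * dimUB Φ.fixedPoints - (dimH Φ.limitSet).toReal * dimLB Φ.fixedPoints) := by
  have hF := Φ.totallyBounded_limitSet.subset Φ.fixedPoints_subset_limitSet
  have hne := Φ.nonempty_fixedPoints
  obtain ⟨a, hL⟩ := Φ.exists_logCov_limitSet_le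
  exact le_of_forall_pos_le_add fun ε hε => dimLB_le_of_frequently
    (frequently_le_of_rate_lt (logCov_mono hF hne) (logCov_nonneg _)
      (fun _ _ hxy => logCov_le_add hF hne hxy) ENNReal.toReal_nonneg (dimLB_nonneg hF hne)
      (dimLB_le_dimUB hF hne) (dimUB_le_dim hF hne)
      (fun s' hs' => frequently_logCov_le_of_dimLB_lt hF hne hs')
      (fun t' ht' => eventually_logCov_le_of_dimUB_lt hF hne ht') hL h hε)

theorem CIFS.max_le_dimLB_limitSet {d : ℕ} (Φ : CIFS d) :
    max (dimH Φ.limitSet).toReal (dimLB Φ.fixedPoints) ≤ dimLB Φ.limitSet := by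
  have hL := Φ.totallyBounded_limitSet
  have hne := Φ.nonempty_fixedPoints.mono Φ.fixedPoints_subset_limitSet
  exact max_le (ENNReal.toReal_le_of_le_ofReal (dimLB_nonneg hL hne) (dimH_le_dimLB hL hne))
    (dimLB_mono Φ.fixedPoints_subset_limitSet hL Φ.nonempty_fixedPoints)

/-- `dim_LB Λ ∈ 𝒟(dim_H Λ, dim_LB F, dim_UB F, d)`; in particular,
if `dim_UB F ≤ dim_H Λ` then `dim_LB Λ = dim_H Λ`, and otherwise
`max{dim_H Λ, dim_LB F} ≤ dim_LB Λ ≤ dim_H Λ + (t-h)(d-h)s/(dt-hs)`. -/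
theorem dimLB_mem_Dset {d : ℕ} (hd : 1 ≤ d) (Phi : CIFS d) :
    dimLB Phi.limitSet ∈
      Dset (dimH Phi.limitSet).toReal (dimLB Phi.fixedPoints) (dimUB Phi.fixedPoints) d ∧
    (dimUB Phi.fixedPoints ≤ (dimH Phi.limitSet).toReal →
      dimLB Phi.limitSet = (dimH Phi.limitSet).toReal) ∧
    ((dimH Phi.limitSet).toReal < dimUB Phi.fixedPoints →
      max (dimH Phi.limitSet).toReal (dimLB Phi.fixedPoints) ≤ dimLB Phi.limitSet ∧
      dimLB Phi.limitSet ≤ (dimH Phi.limitSet).toReal +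
        (dimUB Phi.fixedPoints - (dimH Phi.limitSet).toReal) *
          ((d : ℝ) - (dimH Phi.limitSet).toReal) * dimLB Phi.fixedPoints /
          ((d : ℝ) * dimUB Phi.fixedPoints -
            (dimH Phi.limitSet).toReal * dimLB Phi.fixedPoints)) := by
  have : NeZero d := ⟨by omega⟩
  have hlow := Phi.max_le_dimLB_limitSet
  have heq : dimUB Phi.fixedPoints ≤ (dimH Phi.limitSet).toReal →
      dimLB Phi.limitSet = (dimH Phi.limitSet).toReal := fun h =>
    (Phi.dimLB_limitSet_le_of_le h).antisymm ((le_max_left _ _).trans hlow)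
  refine ⟨?_, heq, fun h => ⟨hlow, Phi.dimLB_limitSet_le_of_lt h⟩⟩
  unfold Dset
  split_ifs with h
  · exact heq h
  · exact ⟨hlow, Phi.dimLB_limitSet_le_of_lt (not_le.1 h)⟩

end
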